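/- Let p be a prime, q = p^m a power of p, n ≥ 1, and let L(X) = Σ_{i=0}^{n-1} a_i X^{q^i} with a_i ∈ F_{q^n} and (a_1, …, a_{n−1}) ≠ (0, …, 0). For each integer 1 ≤ j ≤ q^n−2 with gcd(j, q^n−1) = 1, let ℓ(j) = max{ Lead(Res(j(q^i−1))) : 1 ≤ i ≤ n−1 and a_i ≠ 0 }, and let ℓ = min of ℓ(j) over all such j. Suppose Tr_{q^n/q}(a_0) = 0. If q^n + 1 − ((q−1)(ℓ−1)/2)·⌊2q^{n/2}⌋ > q + 1, then there exists a nonzero x ∈ F_{q^n} with Tr_{q^n/q}(L(x)/x) = 0 (i.e., it is impossible that Tr_{q^n/q}(L(x)/x) ≠ 0 for all nonzero x). -/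

import Mathlib

/-- `leadFn p N j` is the smallest nonnegative integer in the `p`-cyclotomic coset of
`j` modulo `N`, i.e. the smallest `k` with `k ≡ j·p^u (mod N)` for some `u ≥ 0`. -/
noncomputable def leadFn (p N j : ℕ) : ℕ := sInf {k : ℕ | ∃ u : ℕ, k % N = j * p ^ u % N}

section PartA1
open Polynomial

/-- terms with pairwise distinct valuations -/
theorem dv_le {L Γ ι : Type*} [Field L] [LinearOrderedCommGroupWithZero Γ] [DecidableEq ι]
    (v : Valuation L Γ) (s : Finset ι) (F : ι → L)
    (h : ∀ i ∈ s, ∀ j ∈ s, F i ≠ 0 → v (F i) = v (F j) → i = j) :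
    ∀ i ∈ s, v (F i) ≤ v (∑ j ∈ s, F j) := by
  intro i hi
  obtain ⟨j, hj, hmax⟩ := s.exists_max_image (fun i => v (F i)) ⟨i, hi⟩
  by_cases h0 : F j = 0
  · have := hmax i hi
    simp only [h0, map_zero] at this
    exact this.trans zero_le
  · rw [v.map_sum_eq_of_lt hj]
    · exact hmax i hi
    · intro k hk
      simp only [Finset.mem_sdiff, Finset.mem_singleton] at hk
      refine lt_of_le_of_ne (hmax k hk.1) fun he => hk.2 (h j hj k hk.1 h0 he.symm).symm

universe u

theorem exists_val (K : Type u) [Field K] :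
    ∃ (L : Type u) (_ : Field L) (_ : Algebra K L) (_ : IsAlgClosed L) (B : ValuationSubring L) (x : L),
      1 < B.valuation x := by
  let L := AlgebraicClosure (LaurentSeries K)
  let f : PowerSeries K →+* L :=
    (algebraMap (LaurentSeries K) L).comp (algebraMap (PowerSeries K) (LaurentSeries K))
  obtain ⟨B, hB, hloc⟩ := IsLocalRing.exists_factor_valuationRing f
  refine ⟨L, inferInstance, (f.comp (algebraMap K (PowerSeries K))).toAlgebra, inferInstance, B, (f PowerSeries.X)⁻¹, ?_⟩
  have hinj : Function.Injective f :=
    (algebraMap (LaurentSeries K) L).injective.comp (IsFractionRing.injective (PowerSeries K) (LaurentSeries K))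
  have hx0 : f PowerSeries.X ≠ 0 := by
    rw [Ne, map_eq_zero_iff f hinj]; exact PowerSeries.X_ne_zero
  have hlt : B.valuation (f PowerSeries.X) < 1 := by
    have h1 := hB PowerSeries.X
    have h2 : ¬ IsUnit (f.codRestrict _ hB PowerSeries.X) := by
      intro h
      have := hloc.map_nonunit _ h
      rw [PowerSeries.isUnit_iff_constantCoeff] at this
      simp at this
    have := (B.valuation_lt_one_iff (f.codRestrict _ hB PowerSeries.X)).1 (by simpa using h2)
    exact this
  rw [map_inv₀]
  exact (one_lt_inv₀ (by simpa [zero_lt_iff] using hx0)).2 hlt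
end PartA1

section PartA2
open Polynomial

/-- evaluation of a bivariate polynomial -/
noncomputable def bev {K L : Type*} [Field K] [Field L] [Algebra K L] (x y : L) : K[X][X] →+* L :=
  Polynomial.eval₂RingHom (aeval x : K[X] →ₐ[K] L).toRingHom y

noncomputable def asPoly {K : Type*} [Field K] (p : ℕ) (f : K[X]) : K[X][X] := X ^ p - X - C f

theorem asPoly_aux {K : Type*} [Field K] (p : ℕ) (hp : 2 ≤ p) (f : K[X]) :
    (asPoly p f).Monic ∧ (asPoly p f).natDegree = p := by
  have h : (asPoly p f) = X ^ p - (X + C f) := by rw [asPoly]; ring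
  have h2 : (X + C f : K[X][X]).degree < (p : ℕ) := by
    rw [degree_X_add_C]; exact_mod_cast hp
  constructor
  · rw [h]; exact monic_X_pow_sub (by
      rw [degree_X_add_C]
      have : (1 : WithBot ℕ) < (p : ℕ) := by exact_mod_cast hp
      simpa using this)
  · rw [h, natDegree_sub_eq_left_of_natDegree_lt] <;> simp
    omega

theorem bev_red {K L : Type*} [Field K] [Field L] [Algebra K L] (x y : L) (p : ℕ) (hp : 2 ≤ p)
    (f : K[X]) (hy : y ^ p - y = aeval x f) (H : K[X][X]) :
    bev x y H = ∑ j ∈ Finset.range p, aeval x ((H %ₘ asPoly p f).coeff j) * y ^ j := by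
  obtain ⟨hm, hd⟩ := asPoly_aux p hp f
  have h0 : bev x y (asPoly p f) = 0 := by
    simp [bev, asPoly, hy]
  have h1 : bev x y H = bev x y (H %ₘ asPoly p f) := by
    conv_lhs => rw [← modByMonic_add_div H (asPoly p f)]
    rw [map_add, map_mul, h0, zero_mul, add_zero]
  rw [h1]
  have hlt : (H %ₘ asPoly p f).natDegree < p := by
    have := natDegree_modByMonic_lt H hm (by intro h; rw [h] at hd; simp at hd; omega)
    omega
  simp only [bev, coe_eval₂RingHom]
  rw [eval₂_eq_sum_range' _ hlt]
  rfl

section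
variable {K L Γ : Type*} [Field K] [Finite K] [Field L] [Algebra K L]
  [LinearOrderedCommGroupWithZero Γ] (v : Valuation L Γ)

theorem v_const (c : K) (hc : c ≠ 0) : v (algebraMap K L c) = 1 := by
  have := Fintype.ofFinite K
  have h1 : c ^ (Fintype.card K - 1) = 1 := FiniteField.pow_card_sub_one_eq_one c hc
  have h2 : v (algebraMap K L c) ^ (Fintype.card K - 1) = 1 := by
    rw [← map_pow, ← map_pow, h1]; simp
  have h3 : Fintype.card K - 1 ≠ 0 := by
    have := Fintype.one_lt_card (α := K); omega
  exact (pow_eq_one_iff.1 h2).resolve_right h3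

theorem v_poly (x : L) (hx : 1 < v x) (g : K[X]) (hg : g ≠ 0) :
    v (aeval x g) = v x ^ g.natDegree := by
  classical
  have hx0 : (0 : Γ) < v x := lt_trans zero_lt_one hx
  rw [aeval_eq_sum_range, v.map_sum_eq_of_lt (j := g.natDegree) (by simp)]
  · rw [Algebra.smul_def, map_mul, v_const v _ (by simpa using hg), one_mul, map_pow]
  · intro i hi
    simp only [Finset.mem_sdiff, Finset.mem_singleton, Finset.mem_range] at hi
    rw [Algebra.smul_def, map_mul, Algebra.smul_def, map_mul, v_const v (g.coeff g.natDegree) (by simpa using hg),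
      one_mul, map_pow, map_pow]
    have hlt : v x ^ i < v x ^ g.natDegree := pow_lt_pow_right₀ hx (by omega)
    by_cases h : g.coeff i = 0
    · simp only [h, map_zero, zero_mul]; exact pow_pos hx0 _
    · rwa [v_const v _ h, one_mul]

theorem v_y (p d : ℕ) (hp : 2 ≤ p) (hd : 1 ≤ d) (x y : L) (hx : 1 < v x) (f : K[X]) (hf : f.natDegree = d)
    (hy : y ^ p - y = aeval x f) : v y ^ p = v x ^ d := by
  have hf0 : f ≠ 0 := by rintro rfl; simp at hf; omega
  have h1 := v_poly v x hx f hf0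
  rw [hf, ← hy] at h1
  have h2 : 1 < v x ^ d := one_lt_pow₀ hx (by omega)
  have h3 : 1 < v y := by
    by_contra h
    push Not at h
    have : v (y ^ p - y) ≤ 1 := by
      refine (v.map_sub _ _).trans (max_le ?_ h)
      rw [map_pow]; exact pow_le_one' h _
    rw [h1] at this
    exact absurd h2 (not_lt.2 this)
  rw [← h1, v.map_sub_eq_of_lt_left, map_pow]
  rw [map_pow]
  exact lt_self_pow₀ h3 (by omega)

theorem wt_inj (p d : ℕ) (hp : p.Prime) (hd : ¬ p ∣ d) {e j e' j' : ℕ} (hj : j < p) (hj' : j' < p)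
    (h : p * e + d * j = p * e' + d * j') : e = e' ∧ j = j' := by
  have hjj : j = j' := by
    have hc : Nat.Coprime p d := (Nat.Prime.coprime_iff_not_dvd hp).2 hd
    have h1 : d * j ≡ d * j' [MOD p] := by
      have : p * e + d * j ≡ p * e' + d * j' [MOD p] := by rw [h]
      simpa [Nat.ModEq, Nat.add_mod] using this
    have h2 := Nat.ModEq.cancel_left_of_coprime hc h1
    exact Nat.ModEq.eq_of_lt_of_lt h2 hj hj'
  subst hjj
  refine ⟨?_, rfl⟩
  have : p * e = p * e' := by omega
  exact Nat.eq_of_mul_eq_mul_left hp.pos this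

theorem bev_coeff (p d : ℕ) (hp : p.Prime) (hd : ¬ p ∣ d) (x y : L) (hx : 1 < v x)
    (f : K[X]) (hf : f.natDegree = d) (hy : y ^ p - y = aeval x f) (H : K[X][X]) (j : ℕ) (hj : j < p)
    (h0 : (H %ₘ asPoly p f).coeff j ≠ 0) :
    v x ^ (p * ((H %ₘ asPoly p f).coeff j).natDegree + d * j) ≤ v (bev x y H) ^ p := by
  classical
  have hd1 : 1 ≤ d := by rcases Nat.eq_zero_or_pos d with h | h; (subst h; simp at hd); exact h
  have hvy := v_y v p d hp.two_le hd1 x y hx f hf hy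
  have key : ∀ i, (H %ₘ asPoly p f).coeff i ≠ 0 → v (aeval x ((H %ₘ asPoly p f).coeff i) * y ^ i) ^ p
      = v x ^ (p * ((H %ₘ asPoly p f).coeff i).natDegree + d * i) := by
    intro i hi
    rw [map_mul, v_poly v x hx _ hi, map_pow, mul_pow, ← pow_mul, ← pow_mul, mul_comm i p, pow_mul (v y), hvy,
      ← pow_mul, ← pow_add]
    congr 1; ring
  rw [bev_red x y p hp.two_le f hy H, ← key j h0]
  refine pow_le_pow_left₀ zero_le ?_ _
  refine dv_le v _ (fun j => aeval x ((H %ₘ asPoly p f).coeff j) * y ^ j) ?_ j (by simpa using hj)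
  intro i hi k hk hne he
  have hi0 : (H %ₘ asPoly p f).coeff i ≠ 0 := by
    intro h; simp [h] at hne
  have hk0 : (H %ₘ asPoly p f).coeff k ≠ 0 := by
    intro h
    have : v (aeval x ((H %ₘ asPoly p f).coeff i) * y ^ i) = 0 := by
      rw [he]; simp [h]
    exact hne (by simpa using this)
  have := key i hi0
  rw [he, key k hk0] at this
  have h5 := pow_right_injective₀ (lt_trans zero_lt_one hx) hx.ne' this
  exact ((wt_inj p d hp hd (by simpa using hk) (by simpa using hi) h5).2).symm

end
end PartA2

section PartA3
open Polynomial

section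
variable {K : Type*} [Field K]

noncomputable def stG (r : ℕ) {A p I : ℕ} (c : (Fin A × Fin p) × (Fin I × Fin p) → K) : K[X][X] :=
  ∑ t, C (C (c t)) * (C X ^ (t.1.1 : ℕ) * X ^ (t.1.2 : ℕ)) * (C X ^ (t.2.1 : ℕ) * X ^ (t.2.2 : ℕ)) ^ r

noncomputable def stH (r : ℕ) {A p I : ℕ} (c : (Fin A × Fin p) × (Fin I × Fin p) → K) : K[X][X] :=
  ∑ t, C (C (c t ^ r)) * (C X ^ (t.1.1 : ℕ) * X ^ (t.1.2 : ℕ)) ^ r * (C X ^ (t.2.1 : ℕ) * X ^ (t.2.2 : ℕ))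

variable {L : Type*} [Field L] [Algebra K L]

theorem bev_CC (x y : L) (c : K) : bev x y (C (C c)) = algebraMap K L c := by
  simp [bev]
theorem bev_CX (x y : L) : bev x y (C X : K[X][X]) = x := by
  simp [bev]
theorem bev_X (x y : L) : bev x y (X : K[X][X]) = y := by
  simp [bev]

theorem bev_stG (r : ℕ) {A p I : ℕ} (c : (Fin A × Fin p) × (Fin I × Fin p) → K) (x y : L) :
    bev x y (stG r c) = ∑ t, algebraMap K L (c t) * (x ^ (t.1.1 : ℕ) * y ^ (t.1.2 : ℕ)) *
      (x ^ (t.2.1 : ℕ) * y ^ (t.2.2 : ℕ)) ^ r := by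
  simp only [stG, map_sum, map_mul, map_pow, bev_CC, bev_CX, bev_X]

theorem bev_stH (r : ℕ) {A p I : ℕ} (c : (Fin A × Fin p) × (Fin I × Fin p) → K) (x y : L) :
    bev x y (stH r c) = ∑ t, algebraMap K L (c t ^ r) * (x ^ (t.1.1 : ℕ) * y ^ (t.1.2 : ℕ)) ^ r *
      (x ^ (t.2.1 : ℕ) * y ^ (t.2.2 : ℕ)) := by
  simp only [stH, map_sum, map_mul, map_pow, bev_CC, bev_CX, bev_X]

theorem stG_stH (p s r : ℕ) [Fact p.Prime] [Fintype K] [CharP K p] (hr : r = p ^ s) (hK : Fintype.card K = r ^ 2)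
    {A I : ℕ} (c : (Fin A × Fin p) × (Fin I × Fin p) → K) (x y : K) :
    bev x y (stG r c) ^ r = bev x y (stH r c) := by
  rw [bev_stG, bev_stH]
  subst hr
  rw [sum_pow_char_pow]
  refine Finset.sum_congr rfl fun t _ => ?_
  have hx : x ^ (p ^ s) ^ 2 = x := by rw [← hK]; exact FiniteField.pow_card x
  have hy : y ^ (p ^ s) ^ 2 = y := by rw [← hK]; exact FiniteField.pow_card y
  have h1 : ((x ^ (t.2.1 : ℕ) * y ^ (t.2.2 : ℕ)) ^ p ^ s) ^ p ^ s = x ^ (t.2.1 : ℕ) * y ^ (t.2.2 : ℕ) := by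
    rw [← pow_mul, ← pow_two, mul_pow, pow_right_comm, hx, pow_right_comm, hy]
  rw [mul_pow, mul_pow, h1, map_pow]

theorem stH_sub (p s r : ℕ) [Fact p.Prime] [CharP K p] (hr : r = p ^ s)
    {A I : ℕ} (c c' : (Fin A × Fin p) × (Fin I × Fin p) → K) :
    stH r (c - c') = stH r c - stH r c' := by
  simp only [stH, ← Finset.sum_sub_distrib]
  refine Finset.sum_congr rfl fun t _ => ?_
  rw [Pi.sub_apply, hr, sub_pow_char_pow]
  simp only [C_sub]; ring

variable {Γ : Type*} [LinearOrderedCommGroupWithZero Γ] (v : Valuation L Γ)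

theorem v_term (p d r : ℕ) (x y : L) (hvy : v y ^ p = v x ^ d) (a k i j : ℕ) :
    v ((x ^ a * y ^ k) * (x ^ i * y ^ j) ^ r) ^ p = v x ^ ((p * a + d * k) + r * (p * i + d * j)) := by
  simp only [map_mul, map_pow]
  have h : ∀ m, (v y ^ m) ^ p = v x ^ (d * m) := by
    intro m; rw [← pow_mul, mul_comm, pow_mul, hvy, ← pow_mul]
  have : ((v x ^ a * v y ^ k) * (v x ^ i * v y ^ j) ^ r) ^ p =
    (v x ^ (a*p) * (v y ^ k) ^ p) * (v x ^ (i*p) * (v y ^ j) ^ p) ^ r := by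
    rw [mul_pow, pow_right_comm _ r p, mul_pow _ _ p, mul_pow _ _ p, ← pow_mul (v x), ← pow_mul (v x)]
  rw [this, h, h, ← pow_add, ← pow_add, ← pow_mul, ← pow_add]
  congr 1; ring

theorem stG_ne [Finite K] (p d r : ℕ) (hp : p.Prime) (hd : ¬ p ∣ d) {A I : ℕ} (hA : ∀ a < A, ∀ k < p, p * a + d * k < r)
    (x y : L) (hx : 1 < v x) (hvy : v y ^ p = v x ^ d)
    (c : (Fin A × Fin p) × (Fin I × Fin p) → K) (hc : c ≠ 0) : bev x y (stG r c) ≠ 0 := by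
  classical
  obtain ⟨t, ht⟩ : ∃ t, c t ≠ 0 := by
    by_contra h; push Not at h; exact hc (funext h)
  have hx0 : v x ≠ 0 := (lt_trans zero_lt_one hx).ne'
  have key : ∀ t, c t ≠ 0 → v (algebraMap K L (c t) * (x ^ (t.1.1 : ℕ) * y ^ (t.1.2 : ℕ)) *
      (x ^ (t.2.1 : ℕ) * y ^ (t.2.2 : ℕ)) ^ r) ^ p = v x ^ ((p * t.1.1 + d * t.1.2) + r * (p * t.2.1 + d * t.2.2)) := by
    intro t ht
    rw [← v_term v p d r x y hvy, mul_assoc, map_mul, v_const v _ ht, one_mul]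
  have h1 := dv_le v Finset.univ (fun t => algebraMap K L (c t) * (x ^ (t.1.1 : ℕ) * y ^ (t.1.2 : ℕ)) *
      (x ^ (t.2.1 : ℕ) * y ^ (t.2.2 : ℕ)) ^ r) ?_ t (Finset.mem_univ _)
  · intro h0
    rw [bev_stG] at h0
    rw [h0, map_zero] at h1
    have h2 := key t ht
    rw [le_antisymm h1 zero_le, zero_pow hp.ne_zero] at h2
    exact pow_ne_zero _ hx0 h2.symm
  · intro t _ u _ hne he
    have ht0 : c t ≠ 0 := by
      intro h; simp [h] at hne
    have hu0 : c u ≠ 0 := by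
      intro h
      rw [h] at he
      simp only [map_zero, zero_mul] at he
      exact hne (by simpa using he)
    have h3 := key t ht0
    rw [he, key u hu0] at h3
    have h5 := pow_right_injective₀ (lt_trans zero_lt_one hx) hx.ne' h3
    have b1 := hA t.1.1 t.1.1.2 t.1.2 t.1.2.2
    have b2 := hA u.1.1 u.1.1.2 u.1.2 u.1.2.2
    have e1 : p * (u.1.1 : ℕ) + d * u.1.2 = p * t.1.1 + d * t.1.2 := by
      have := congrArg (· % r) h5
      simpa [Nat.add_mul_mod_self_left, Nat.mod_eq_of_lt b1, Nat.mod_eq_of_lt b2] using this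
    have e2 : p * (u.2.1 : ℕ) + d * u.2.2 = p * t.2.1 + d * t.2.2 := by
      rw [e1] at h5
      have : r * (p * (u.2.1 : ℕ) + d * u.2.2) = r * (p * t.2.1 + d * t.2.2) := by omega
      exact Nat.eq_of_mul_eq_mul_left (by omega) this
    obtain ⟨q1, q2⟩ := wt_inj p d hp hd u.1.2.2 t.1.2.2 e1
    obtain ⟨q3, q4⟩ := wt_inj p d hp hd u.2.2.2 t.2.2.2 e2
    exact (Prod.ext (Prod.ext (Fin.ext q1) (Fin.ext q2)) (Prod.ext (Fin.ext q3) (Fin.ext q4))).symm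

set_option maxHeartbeats 2000000 in
/-- the point count bound -/
theorem stepanov_count [Fintype K] [DecidableEq K] (p d s r : ℕ) [hp : Fact p.Prime] [CharP K p] (hd : ¬ p ∣ d)
    (hs : 1 ≤ s) (hr : r = p ^ s) (hK : Fintype.card K = r ^ 2) (hbig : (d * p + 1) ^ 2 ≤ r)
    (f : K[X]) (hf : f.natDegree = d) (Z : Finset K) (hZ : ∀ x ∈ Z, ∃ y : K, y ^ p - y = f.eval x) :
    p * Z.card ≤ r ^ 2 + r * (1 + 2 * d * p) := by
  have hpp := hp.out
  have hp2 := hpp.two_le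
  have hd1 : 1 ≤ d := by rcases Nat.eq_zero_or_pos d with h | h; (subst h; simp at hd); exact h
  obtain ⟨s, rfl⟩ : ∃ s', s = s' + 1 := ⟨s - 1, by omega⟩
  set R := p ^ s with hR
  have hrR : r = p * R := by rw [hr, pow_succ]; ring
  have hRd : d ≤ R := by
    have : p * d ≤ p * R := by rw [← hrR]; nlinarith
    exact Nat.le_of_mul_le_mul_left this hpp.pos
  obtain ⟨A, hA⟩ : ∃ A, R = A + d := ⟨R - d, by omega⟩
  set I := R + d with hI
  obtain ⟨L, _, _, _, B, x, hx⟩ := exists_val K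
  obtain ⟨y, hy⟩ : ∃ y : L, y ^ p - y = aeval x f := by
    obtain ⟨y, hy⟩ := IsAlgClosed.exists_root (X ^ p - (X + C (aeval x f)) : L[X]) (by
      have : (X ^ p - (X + C (aeval x f)) : L[X]).natDegree = p := by
        rw [natDegree_sub_eq_left_of_natDegree_lt] <;> simp
        omega
      intro h
      have := natDegree_eq_of_degree_eq_some (n := 0) (by simpa using h)
      omega)
    refine ⟨y, ?_⟩
    simp only [IsRoot.def, eval_sub, eval_pow, eval_X, eval_add, eval_C] at hy
    linear_combination hy
  set v := B.valuation
  have hvy : v y ^ p = v x ^ d := v_y v p d hp2 hd1 x y hx f hf hy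
  have hAr : ∀ a < A, ∀ k < p, p * a + d * k + p + d ≤ r := by
    intro a ha k hk
    rw [hrR, hA]
    have h1 : p * (a + 1) ≤ p * A := Nat.mul_le_mul_left _ ha
    have h2 : d * (k + 1) ≤ d * p := Nat.mul_le_mul_left _ hk
    nlinarith
  -- bound for H
  set W0 := r * (r - p - d) + p * I + d * p - p - d with hW0
  have hpd : p + d ≤ r := by
    have h1 : p + d ≤ d * p + 1 := by
      obtain ⟨a, rfl⟩ := Nat.exists_eq_add_of_le hp2
      obtain ⟨b, rfl⟩ := Nat.exists_eq_add_of_le hd1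
      nlinarith [Nat.zero_le (a * b)]
    exact h1.trans ((Nat.le_self_pow (by norm_num) _).trans hbig)
  have hHb : ∀ c : (Fin A × Fin p) × (Fin I × Fin p) → K, v (bev x y (stH r c)) ^ p ≤ v x ^ W0 := by
    intro c
    rw [bev_stH]
    have hterm : ∀ t : (Fin A × Fin p) × (Fin I × Fin p), v (algebraMap K L (c t ^ r) * (x ^ (t.1.1 : ℕ) * y ^ (t.1.2 : ℕ)) ^ r *
      (x ^ (t.2.1 : ℕ) * y ^ (t.2.2 : ℕ))) ^ p ≤ v x ^ W0 := by
      intro t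
      have h1 : v (algebraMap K L (c t ^ r)) ≤ 1 := by
        by_cases h : c t ^ r = 0
        · rw [h]; simp
        · rw [v_const v _ h]
      rw [mul_assoc, map_mul, mul_pow]
      have h2 : v ((x ^ (t.1.1 : ℕ) * y ^ (t.1.2 : ℕ)) ^ r * (x ^ (t.2.1 : ℕ) * y ^ (t.2.2 : ℕ))) ^ p ≤ v x ^ W0 := by
        rw [mul_comm, v_term v p d r x y hvy]
        refine pow_le_pow_right₀ hx.le ?_
        have b1 : p * (t.1.1 : ℕ) + d * t.1.2 ≤ r - p - d := by
          have := hAr t.1.1 t.1.1.2 t.1.2 t.1.2.2; omega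
        have b2 := Nat.mul_le_mul_left r b1
        have b3 : p * ((t.2.1 : ℕ) + 1) ≤ p * I := Nat.mul_le_mul_left _ t.2.1.2
        have b4 : d * ((t.2.2 : ℕ) + 1) ≤ d * p := Nat.mul_le_mul_left _ t.2.2.2
        rw [mul_add] at b3 b4
        omega
      calc _ ≤ 1 * v x ^ W0 := mul_le_mul' (pow_le_one' h1 _) h2
        _ = _ := one_mul _
    by_cases hne : (Finset.univ : Finset ((Fin A × Fin p) × (Fin I × Fin p))).Nonempty
    · obtain ⟨t, -, ht⟩ := Finset.exists_max_image Finset.univ (fun t => v (algebraMap K L (c t ^ r) * (x ^ (t.1.1 : ℕ) * y ^ (t.1.2 : ℕ)) ^ r *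
        (x ^ (t.2.1 : ℕ) * y ^ (t.2.2 : ℕ)))) hne
      exact (pow_le_pow_left₀ zero_le (v.map_sum_le ht) p).trans (hterm t)
    · rw [Finset.not_nonempty_iff_eq_empty.1 hne]
      simp [hpp.ne_zero]
  set N := W0 / p + 1 with hN
  have hdeg : ∀ (c : (Fin A × Fin p) × (Fin I × Fin p) → K) (j : ℕ),
      ((stH r c) %ₘ asPoly p f).coeff j ≠ 0 → j < p ∧ (((stH r c) %ₘ asPoly p f).coeff j).natDegree < N := by
    intro c j hj
    have hjp : j < p := by
      by_contra h
      apply hj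
      apply coeff_eq_zero_of_natDegree_lt
      obtain ⟨hm, hd⟩ := asPoly_aux p hp2 f
      have := natDegree_modByMonic_lt (stH r c) hm (by intro h; rw [h] at hd; simp at hd; omega)
      omega
    refine ⟨hjp, ?_⟩
    have h1 := (bev_coeff v p d hpp hd x y hx f hf hy (stH r c) j hjp hj).trans (hHb c)
    have h2 : p * (((stH r c) %ₘ asPoly p f).coeff j).natDegree + d * j ≤ W0 := by
      by_contra h
      push Not at h
      exact absurd (pow_lt_pow_right₀ hx h) (not_lt.2 h1)
    have h3 : (((stH r c) %ₘ asPoly p f).coeff j).natDegree ≤ W0 / p := by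
      rw [Nat.le_div_iff_mul_le hpp.pos]; nlinarith
    omega
  -- pigeonhole
  have hcard : Fintype.card (Fin p × Fin N → K) < Fintype.card ((Fin A × Fin p) × (Fin I × Fin p) → K) := by
    simp only [Fintype.card_fun, Fintype.card_prod, Fintype.card_fin]
    refine Nat.pow_lt_pow_right Fintype.one_lt_card ?_
    have h1 : p * N ≤ W0 + p := by
      rw [hN, mul_add, mul_one]; have := Nat.mul_div_le W0 p; omega
    refine h1.trans_lt ?_
    have h2 : W0 + p ≤ r * (r - p - d) + p * I + d * p := by
      have : p * 1 ≤ p * I := Nat.mul_le_mul_left _ (by omega)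
      have : d * 1 ≤ d * p := Nat.mul_le_mul_left _ (by omega)
      omega
    refine h2.trans_lt ?_
    obtain ⟨r', hr'⟩ : ∃ r', r = r' + p + d := ⟨r - p - d, by omega⟩
    have h3 : r - p - d = r' := by omega
    rw [h3]
    have h4 : A * p * (I * p) = (A * p) * (r + d * p) := by
      rw [hI, hrR]; ring
    rw [h4]
    have h5 : p * I = r + d * p := by rw [hI, hrR]; ring
    rw [h5]
    zify
    have h6 : (A : ℤ) * p = r - d * p := by
      have : (r : ℤ) = p * (A + d) := by rw [hrR, hA]; push_cast; ring
      rw [this]; ring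
    have h7 : (r' : ℤ) = r - p - d := by rw [hr']; push_cast; ring
    rw [h6, h7]
    have h8 : ((d * p + 1) ^ 2 : ℤ) ≤ r := by exact_mod_cast hbig
    have h9 : (2 : ℤ) ≤ p := by exact_mod_cast hp2
    have h10 : (1 : ℤ) ≤ d := by exact_mod_cast hd1
    have h11 : (0 : ℤ) ≤ r := by positivity
    nlinarith [mul_nonneg h11 (sub_nonneg.2 h9), mul_nonneg h11 (sub_nonneg.2 h10)]
  obtain ⟨c1, c2, hne, heq⟩ := Fintype.exists_ne_map_eq_of_card_lt
    (fun (c : (Fin A × Fin p) × (Fin I × Fin p) → K) (t : Fin p × Fin N) =>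
      (((stH r c) %ₘ asPoly p f).coeff t.1).coeff t.2) hcard
  have hHeq : (stH r c1) %ₘ asPoly p f = (stH r c2) %ₘ asPoly p f := by
    ext j e
    by_cases hje : j < p ∧ e < N
    · exact congrFun heq (⟨j, hje.1⟩, ⟨e, hje.2⟩)
    · have : ∀ c : (Fin A × Fin p) × (Fin I × Fin p) → K, (((stH r c) %ₘ asPoly p f).coeff j).coeff e = 0 := by
        intro c
        by_cases h0 : ((stH r c) %ₘ asPoly p f).coeff j = 0
        · rw [h0]; simp
        · obtain ⟨q1, q2⟩ := hdeg c j h0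
          apply coeff_eq_zero_of_natDegree_lt
          by_contra h
          exact hje ⟨q1, by omega⟩
      rw [this, this]
  set c := c1 - c2 with hcdef
  have hc : c ≠ 0 := sub_ne_zero.2 hne
  have hH0 : (stH r c) %ₘ asPoly p f = 0 := by
    rw [hcdef, stH_sub p (s+1) r hr, sub_modByMonic, hHeq, sub_self]
  have hG0 : ∀ x ∈ Z, ∀ y : K, y ^ p - y = f.eval x → bev x y (stG r c) = 0 := by
    intro x _ y hy
    have h1 := stG_stH p (s+1) r hr hK c x y
    rw [bev_red x y p hp2 f (by simpa [aeval_def] using hy) (stH r c), hH0] at h1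
    simp only [coeff_zero, map_zero, zero_mul, Finset.sum_const_zero] at h1
    exact pow_eq_zero_iff (by omega) |>.1 h1
  have hGne := stG_ne v p d r hpp hd (fun a ha k hk => by have := hAr a ha k hk; omega) x y hx hvy c hc
  obtain ⟨j, hj, hgj⟩ : ∃ j < p, (stG r c %ₘ asPoly p f).coeff j ≠ 0 := by
    by_contra h
    push Not at h
    apply hGne
    rw [bev_red x y p hp2 f hy]
    exact Finset.sum_eq_zero fun j hj => by rw [h j (by simpa using hj)]; simp
  set g := (stG r c %ₘ asPoly p f).coeff j with hg
  -- roots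
  have hroot : ∀ z ∈ Z, g.eval z = 0 := by
    intro z hz
    obtain ⟨y0, hy0⟩ := hZ z hz
    set Pz : K[X] := (stG r c %ₘ asPoly p f).map (evalRingHom z) with hPz
    have hPdeg : Pz.natDegree < p := by
      obtain ⟨hm, hd⟩ := asPoly_aux p hp2 f
      have := natDegree_modByMonic_lt (stG r c) hm (by intro h; rw [h] at hd; simp at hd; omega)
      exact lt_of_le_of_lt natDegree_map_le (by omega)
    have hP0 : Pz = 0 := by
      have hval : ∀ i ∈ Finset.univ.image (fun u : ZMod p => y0 + (ZMod.castHom (dvd_refl p) K u)), Pz.eval i = 0 := by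
        intro i hi
        simp only [Finset.mem_image, Finset.mem_univ, true_and] at hi
        obtain ⟨u, rfl⟩ := hi
        set w := y0 + (ZMod.castHom (dvd_refl p) K u) with hw
        have hwp : w ^ p - w = f.eval z := by
          rw [hw, add_pow_char, ← map_pow, ZMod.pow_card, ← hy0]; ring
        have h1 := hG0 z hz w hwp
        rw [bev_red z w p hp2 f (by simpa [aeval_def] using hwp)] at h1
        rw [eval_eq_sum_range' hPdeg, ← h1]
        refine Finset.sum_congr rfl fun i _ => ?_
        simp [hPz, coeff_map, aeval_def]
      apply eq_zero_of_natDegree_lt_card_of_eval_eq_zero' Pz _ hval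
      rw [Finset.card_image_of_injective]
      · simpa [ZMod.card] using hPdeg
      · intro a b hab
        exact (ZMod.castHom (dvd_refl p) K).injective (by simpa using hab)
    have := congrArg (fun q => q.coeff j) hP0
    simpa [hPz, coeff_map] using this
  have hZcard : Z.card ≤ g.natDegree := by
    by_contra h
    push Not at h
    exact hgj (eq_zero_of_natDegree_lt_card_of_eval_eq_zero' g Z hroot h)
  -- degree of g
  have hb := bev_coeff v p d hpp hd x y hx f hf hy (stG r c) j hj hgj
  have hGb : v (bev x y (stG r c)) ^ p ≤ v x ^ (r + r * (p * I + d * p)) := by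
    rw [bev_stG]
    have hterm : ∀ t : (Fin A × Fin p) × (Fin I × Fin p), v (algebraMap K L (c t) * (x ^ (t.1.1 : ℕ) * y ^ (t.1.2 : ℕ)) *
      (x ^ (t.2.1 : ℕ) * y ^ (t.2.2 : ℕ)) ^ r) ^ p ≤ v x ^ (r + r * (p * I + d * p)) := by
      intro t
      have h1 : v (algebraMap K L (c t)) ≤ 1 := by
        by_cases h : c t = 0
        · rw [h]; simp
        · rw [v_const v _ h]
      rw [mul_assoc, map_mul, mul_pow]
      have h2 : v ((x ^ (t.1.1 : ℕ) * y ^ (t.1.2 : ℕ)) * (x ^ (t.2.1 : ℕ) * y ^ (t.2.2 : ℕ)) ^ r) ^ p ≤ v x ^ (r + r * (p * I + d * p)) := by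
        rw [v_term v p d r x y hvy]
        refine pow_le_pow_right₀ hx.le ?_
        have b1 := hAr t.1.1 t.1.1.2 t.1.2 t.1.2.2
        have b3 : p * ((t.2.1 : ℕ)) ≤ p * I := Nat.mul_le_mul_left _ t.2.1.2.le
        have b4 : d * ((t.2.2 : ℕ)) ≤ d * p := Nat.mul_le_mul_left _ t.2.2.2.le
        have b5 := Nat.mul_le_mul_left r (Nat.add_le_add b3 b4)
        omega
      calc _ ≤ 1 * _ := mul_le_mul' (pow_le_one' h1 _) h2
        _ = _ := one_mul _
    obtain ⟨t, -, ht⟩ := Finset.exists_max_image Finset.univ (fun t => v (algebraMap K L (c t) * (x ^ (t.1.1 : ℕ) * y ^ (t.1.2 : ℕ)) *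
        (x ^ (t.2.1 : ℕ) * y ^ (t.2.2 : ℕ)) ^ r)) (by
        by_contra hne
        apply hGne
        rw [bev_stG, Finset.not_nonempty_iff_eq_empty.1 hne]; simp)
    exact (pow_le_pow_left₀ zero_le (v.map_sum_le ht) p).trans (hterm t)
  have h2 : p * g.natDegree + d * j ≤ r + r * (p * I + d * p) := by
    by_contra h
    push Not at h
    exact absurd (pow_lt_pow_right₀ hx h) (not_lt.2 (hb.trans hGb))
  have h5 : p * I = r + d * p := by rw [hI, hrR]; ring
  rw [h5] at h2
  have := Nat.mul_le_mul_left p hZcard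
  nlinarith
end
end PartA3

section PartA4
open Polynomial

theorem hilbert90_add {K : Type*} [Field K] [Finite K] (p : ℕ) [hp : Fact p.Prime] [CharP K p] [Algebra (ZMod p) K]
    (z : K) (hz : Algebra.trace (ZMod p) K z = 0) : ∃ y : K, y ^ p - y = z := by
  classical
  have := Fintype.ofFinite K
  let P : K →+ K := (frobenius K p).toAddMonoidHom - AddMonoidHom.id K
  have hP : ∀ y, P y = y ^ p - y := fun y => by simp [P, frobenius_def]
  let T : K →+ ZMod p := (Algebra.trace (ZMod p) K).toAddMonoidHom
  have hT : ∀ y, T y = Algebra.trace (ZMod p) K y := fun y => rfl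
  have hle : P.range ≤ T.ker := by
    rintro _ ⟨y, rfl⟩
    rw [AddMonoidHom.mem_ker, hP, hT, map_sub, sub_eq_zero]
    have h := FiniteField.frobeniusAlgEquiv (ZMod p) K p
    apply (algebraMap (ZMod p) K).injective
    rw [FiniteField.algebraMap_trace_eq_sum_pow, FiniteField.algebraMap_trace_eq_sum_pow]
    simp only [Nat.card_zmod]
    have h1 : ∀ i, (y ^ p) ^ p ^ i = y ^ p ^ (i+1) := by
      intro i; rw [← pow_mul, pow_succ']
    simp only [h1]
    have h2 := Finset.sum_range_succ (fun i => y ^ p ^ i) (Module.finrank (ZMod p) K)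
    rw [Finset.sum_range_succ'] at h2
    have h3 : y ^ p ^ (Module.finrank (ZMod p) K) = y := by
      have : p ^ (Module.finrank (ZMod p) K) = Fintype.card K := by
        rw [Module.card_eq_pow_finrank (K := ZMod p) (V := K), ZMod.card]
      rw [this, FiniteField.pow_card]
    rw [h3] at h2
    simpa using h2
  have hker : Nat.card P.ker ≤ p := by
    have : (P.ker : Set K) ⊆ ((X ^ p - X : K[X]).roots.toFinset : Set K) := by
      intro y hy
      have hy : y ^ p - y = 0 := by rw [← hP]; exact hy
      simp only [Finset.mem_coe, Multiset.mem_toFinset]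
      rw [mem_roots (FiniteField.X_pow_card_sub_X_ne_zero K hp.out.one_lt)]
      simpa using hy
    have h2 := Set.ncard_le_ncard this (Finset.finite_toSet _)
    rw [Set.ncard_coe_finset] at h2
    have h3 : (X ^ p - X : K[X]).roots.toFinset.card ≤ p :=
      (Multiset.toFinset_card_le _).trans ((card_roots' _).trans
        (FiniteField.X_pow_card_sub_X_natDegree_eq K hp.out.one_lt).le)
    exact h2.trans h3
  have hsurj : Function.Surjective T := Algebra.trace_surjective (ZMod p) K
  have e1 : Nat.card P.ker * Nat.card P.range = Nat.card K := by
    rw [← AddSubgroup.index_ker, mul_comm]; exact AddSubgroup.index_mul_card _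
  have e2 : Nat.card T.ker * p = Nat.card K := by
    have : p = Nat.card T.range := by
      rw [AddMonoidHom.range_eq_top.2 hsurj]; simp
    refine (congrArg (fun w => Nat.card T.ker * w) this).trans ?_
    rw [← AddSubgroup.index_ker, mul_comm]; exact AddSubgroup.index_mul_card _
  have hcard : Nat.card T.ker ≤ Nat.card P.range := by
    have : Nat.card T.ker * p ≤ Nat.card P.range * p := by
      rw [e2, ← e1, mul_comm]; exact Nat.mul_le_mul_left _ hker
    exact Nat.le_of_mul_le_mul_right this hp.out.pos
  have heq : P.range = T.ker := AddSubgroup.eq_of_le_of_card_ge hle hcard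
  have hz' : z ∈ P.range := by rw [heq]; exact hz
  obtain ⟨y, hy⟩ := hz'
  exact ⟨y, by rw [← hP]; exact hy⟩

theorem stepanov_sum {K : Type*} [Field K] [Fintype K] (p d s r : ℕ) [hp : Fact p.Prime] [CharP K p] [Algebra (ZMod p) K]
    (hd : ¬ p ∣ d)
    (hs : 1 ≤ s) (hr : r = p ^ s) (hK : Fintype.card K = r ^ 2) (hbig : (d * p + 1) ^ 2 ≤ r)
    (f : K[X]) (hf : f.natDegree = d) (e : ZMod p → ℂ) (he : ∀ a, ‖e a‖ ≤ 1) (hsum : ∑ a, e a = 0) :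
    ‖∑ x : K, e (Algebra.trace (ZMod p) K (f.eval x))‖ ≤ (p * (1 + 2 * d * p) : ℕ) * (r : ℝ) := by
  classical
  set Z : ZMod p → Finset K := fun a => Finset.univ.filter (fun x => Algebra.trace (ZMod p) K (f.eval x) = a) with hZ
  set D : ℕ := 1 + 2 * d * p with hD
  have hd1 : 1 ≤ d := by rcases Nat.eq_zero_or_pos d with h | h; (subst h; simp at hd); exact h
  have hup : ∀ a, p * (Z a).card ≤ r ^ 2 + r * D := by
    intro a
    obtain ⟨b, hb⟩ := Algebra.trace_surjective (ZMod p) K a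
    refine stepanov_count p d s r hd hs hr hK hbig (f - C b) (by rw [natDegree_sub_C, hf]) (Z a) ?_
    intro x hx
    simp only [hZ, Finset.mem_filter, Finset.mem_univ, true_and] at hx
    refine hilbert90_add p _ ?_
    rw [eval_sub, eval_C, map_sub, hx, hb, sub_self]
  have htot : ∑ a, (Z a).card = r ^ 2 := by
    rw [← hK, ← Finset.card_univ]
    exact (Finset.card_eq_sum_card_fiberwise (fun x _ => Finset.mem_univ _)).symm
  have hS : ∑ x : K, e (Algebra.trace (ZMod p) K (f.eval x)) = ∑ a, ((Z a).card : ℂ) * e a := by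
    rw [← Finset.sum_fiberwise_of_maps_to (t := Finset.univ) (g := fun x : K => Algebra.trace (ZMod p) K (f.eval x))
      (fun x _ => Finset.mem_univ _)]
    refine Finset.sum_congr rfl fun a _ => ?_
    rw [Finset.sum_congr rfl (g := fun _ => e a) (by intro x hx; rw [(Finset.mem_filter.1 hx).2])]
    simp [hZ]
  have hp0 : (0 : ℝ) < p := by exact_mod_cast hp.out.pos
  have hS2 : (p : ℂ) * ∑ x : K, e (Algebra.trace (ZMod p) K (f.eval x)) = ∑ a, ((p : ℂ) * (Z a).card - (r ^ 2 + r * D)) * e a := by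
    rw [hS]
    simp only [sub_mul, Finset.sum_sub_distrib, ← Finset.mul_sum, hsum, mul_zero, sub_zero]
    rw [Finset.mul_sum]
    exact Finset.sum_congr rfl fun a _ => by ring
  have hb : ∀ a, ‖((p : ℂ) * (Z a).card - (r ^ 2 + r * D)) * e a‖ ≤ (r ^ 2 + r * D : ℝ) - p * (Z a).card := by
    intro a
    rw [norm_mul]
    have h1 : ‖((p : ℂ) * (Z a).card - (r ^ 2 + r * D))‖ = (r ^ 2 + r * D : ℝ) - p * (Z a).card := by
      have : ((p : ℂ) * (Z a).card - (r ^ 2 + r * D)) = (((p : ℝ) * (Z a).card - (r ^ 2 + r * D) : ℝ) : ℂ) := by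
        push_cast; ring
      rw [this, Complex.norm_real, Real.norm_eq_abs, abs_of_nonpos]
      · ring
      · have : ((p * (Z a).card : ℕ) : ℝ) ≤ ((r ^ 2 + r * D : ℕ) : ℝ) := by exact_mod_cast hup a
        push_cast at this; linarith
    rw [h1]
    refine mul_le_of_le_one_right ?_ (he a)
    rw [← h1]; positivity
  have h3 : p * ‖∑ x : K, e (Algebra.trace (ZMod p) K (f.eval x))‖ ≤ p * (r * D) := by
    have h4 : ‖(p : ℂ) * ∑ x : K, e (Algebra.trace (ZMod p) K (f.eval x))‖ ≤ ∑ a, ((r ^ 2 + r * D : ℝ) - p * (Z a).card) := by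
      rw [hS2]; exact (norm_sum_le _ _).trans (Finset.sum_le_sum fun a _ => hb a)
    rw [norm_mul, Complex.norm_natCast] at h4
    refine h4.trans (le_of_eq ?_)
    rw [Finset.sum_sub_distrib, ← Finset.mul_sum]
    have : (∑ a, ((Z a).card : ℝ)) = r ^ 2 := by exact_mod_cast htot
    rw [this]
    simp [ZMod.card]
  have h5 := le_of_mul_le_mul_left h3 hp0
  refine h5.trans ?_
  push_cast
  have hp1 : (1 : ℝ) ≤ p := by exact_mod_cast hp.out.one_le
  have : (0 : ℝ) ≤ r * D := by positivity
  rw [hD] at this ⊢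
  push_cast at this ⊢
  nlinarith
end PartA4

section PartB1
open PowerSeries

section
variable {k : Type*} [Field k]

/-- minus `X` times the logarithmic derivative -/
noncomputable def lder (u : k⟦X⟧) : k⟦X⟧ := -(X * derivative k u * u⁻¹)

theorem lder_mul (u v : k⟦X⟧) (hu : constantCoeff u ≠ 0) (hv : constantCoeff v ≠ 0) :
    lder (u * v) = lder u + lder v := by
  have h1 := PowerSeries.mul_inv_cancel u hu
  have h2 := PowerSeries.mul_inv_cancel v hv
  simp only [lder, PowerSeries.mul_inv_rev, Derivation.leibniz, smul_eq_mul]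
  linear_combination (-X * derivative k u * u⁻¹) * h2 + (-X * derivative k v * v⁻¹) * h1

theorem lder_one : lder (1 : k⟦X⟧) = 0 := by
  simp [lder]

noncomputable def lam (f : Polynomial k) (u : k⟦X⟧) : k :=
  ∑ i ∈ Finset.range (f.natDegree + 1), f.coeff i * coeff i (lder u)

theorem lam_mul (f : Polynomial k) (u v : k⟦X⟧) (hu : constantCoeff u ≠ 0) (hv : constantCoeff v ≠ 0) :
    lam f (u * v) = lam f u + lam f v := by
  simp only [lam, lder_mul u v hu hv, map_add, mul_add, Finset.sum_add_distrib]

theorem lam_one (f : Polynomial k) : lam f 1 = 0 := by simp [lam, lder_one]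

theorem lam_pow (f : Polynomial k) (u : k⟦X⟧) (hu : constantCoeff u ≠ 0) (n : ℕ) :
    lam f (u ^ n) = n • lam f u := by
  induction n with
  | zero => simp [lam_one]
  | succ n ih => rw [pow_succ, lam_mul _ _ _ (by simp [hu]) hu, ih, succ_nsmul]

theorem lam_perturb (f : Polynomial k) (hd : 1 ≤ f.natDegree) (u w : k⟦X⟧) (hu : constantCoeff u = 1) :
    lam f (u + X ^ f.natDegree * w) = lam f u - f.natDegree * f.leadingCoeff * constantCoeff w := by
  set d := f.natDegree with hdd
  obtain ⟨D, hD⟩ : ∃ D, d = D + 1 := ⟨d - 1, by omega⟩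
  have hu0 : constantCoeff u ≠ 0 := by rw [hu]; exact one_ne_zero
  set z := w * u⁻¹ with hz
  have h1 : u + X ^ d * w = u * (1 + X ^ d * z) := by
    have := PowerSeries.mul_inv_cancel u hu0
    rw [hz]; linear_combination (- X ^ d * w) * this
  have hz0 : constantCoeff z = constantCoeff w := by simp [hz, hu]
  have hc : constantCoeff (1 + X ^ d * z) = 1 := by simp [hD]
  rw [h1, lam_mul _ _ _ hu0 (by rw [hc]; exact one_ne_zero), sub_eq_add_neg]
  congr 1
  have h2 : lder (1 + X ^ d * z) = X ^ d * (-((d : k⟦X⟧) * z + X * derivative k z) * (1 + X ^ d * z)⁻¹) := by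
    simp only [lder, map_add, Derivation.leibniz, smul_eq_mul, Derivation.leibniz_pow, derivative_X]
    have : derivative k (1 : k⟦X⟧) = 0 := by simp
    rw [this, hD]
    simp only [Nat.add_sub_cancel, nsmul_eq_mul]
    push_cast
    ring
  rw [lam, h2, Finset.sum_range_succ, Finset.sum_eq_zero]
  · rw [zero_add, coeff_X_pow_mul', if_pos le_rfl, Nat.sub_self, coeff_zero_eq_constantCoeff_apply]
    simp only [map_mul, map_neg, map_add, constantCoeff_X, zero_mul, add_zero, hz0, constantCoeff_inv, hc, map_natCast]
    rw [Polynomial.leadingCoeff, ← hdd]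
    simp; ring
  · intro i hi
    rw [coeff_X_pow_mul', if_neg (by simp at hi; omega), mul_zero]
end
end PartB1

section PartB2
open PowerSeries

section
variable {k : Type*} [Field k] [Finite k]

theorem finite_natDegree_le (n : ℕ) : {g : Polynomial k | g.natDegree ≤ n}.Finite := by
  have h : Finite (Fin (n+1) → k) := inferInstance
  refine Set.Finite.of_injOn (f := fun g : Polynomial k => fun i : Fin (n+1) => g.coeff i) (t := Set.univ)
    (fun _ _ => Set.mem_univ _) ?_ Set.finite_univ
  intro g hg h hh hgh
  ext i
  by_cases hi : i < n + 1
  · exact congrFun hgh ⟨i, hi⟩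
  · simp only [Set.mem_setOf_eq] at hg hh
    rw [Polynomial.coeff_eq_zero_of_natDegree_lt (by omega), Polynomial.coeff_eq_zero_of_natDegree_lt (by omega)]

variable (k) in
noncomputable def monF (n : ℕ) : Finset (Polynomial k) :=
  ((finite_natDegree_le n).subset (s := {g : Polynomial k | g.natDegree ≤ n})
    (t := {g : Polynomial k | g.Monic ∧ g.natDegree = n}) (fun _ h => h.2.le)).toFinset

theorem mem_monF {n : ℕ} {g : Polynomial k} : g ∈ monF k n ↔ g.Monic ∧ g.natDegree = n := by
  simp [monF]

variable (k) in
noncomputable def VF (n : ℕ) : Finset (Polynomial k) :=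
  ((finite_natDegree_le n).subset (s := {g : Polynomial k | g.natDegree ≤ n})
    (t := {g : Polynomial k | g.coeff 0 = 1 ∧ g.natDegree ≤ n}) (fun _ h => h.2)).toFinset

theorem mem_VF {n : ℕ} {g : Polynomial k} : g ∈ VF k n ↔ g.coeff 0 = 1 ∧ g.natDegree ≤ n := by
  simp [VF]

/-- the character -/
noncomputable def chi (ψ : AddChar k ℂ) (f : Polynomial k) (u : Polynomial k) : ℂ :=
  ψ (lam f (u : k⟦X⟧))

noncomputable def Msum (ψ : AddChar k ℂ) (f : Polynomial k) (n : ℕ) : ℂ :=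
  ∑ g ∈ monF k n, chi ψ f g.reverse

theorem Msum_eq (ψ : AddChar k ℂ) (f : Polynomial k) (n : ℕ) :
    Msum ψ f n = ∑ u ∈ VF k n, chi ψ f u := by
  refine Finset.sum_bij' (fun g _ => g.reverse) (fun u _ => u.reflect n) ?_ ?_ ?_ ?_ ?_
  · intro g hg
    obtain ⟨h1, h2⟩ := mem_monF.1 hg
    rw [mem_VF]
    exact ⟨by simp [h1], (Polynomial.reverse_natDegree_le g).trans h2.le⟩
  · intro u hu
    obtain ⟨h1, h2⟩ := mem_VF.1 hu
    have h3 : (u.reflect n).natDegree ≤ n := by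
      rw [Polynomial.natDegree_le_iff_coeff_eq_zero]
      intro i hi
      rw [Polynomial.coeff_reflect, Polynomial.revAt_eq_self_of_lt hi]
      exact Polynomial.coeff_eq_zero_of_natDegree_lt (by omega)
    have h4 : (u.reflect n).coeff n = 1 := by
      rw [Polynomial.coeff_reflect, Polynomial.revAt_le le_rfl]; simpa using h1
    rw [mem_monF]
    refine ⟨Polynomial.monic_of_natDegree_le_of_coeff_eq_one _ h3 h4, le_antisymm h3 ?_⟩
    exact Polynomial.le_natDegree_of_ne_zero (by rw [h4]; exact one_ne_zero)
  · intro g hg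
    obtain ⟨h1, h2⟩ := mem_monF.1 hg
    ext i
    simp [Polynomial.reverse, h2, Polynomial.coeff_reflect]
  · intro u hu
    obtain ⟨h1, h2⟩ := mem_VF.1 hu
    have h3 : (u.reflect n).natDegree = n := by
      refine le_antisymm ?_ ?_
      · rw [Polynomial.natDegree_le_iff_coeff_eq_zero]
        intro i hi
        rw [Polynomial.coeff_reflect, Polynomial.revAt_eq_self_of_lt hi]
        exact Polynomial.coeff_eq_zero_of_natDegree_lt (by omega)
      · apply Polynomial.le_natDegree_of_ne_zero
        rw [Polynomial.coeff_reflect, Polynomial.revAt_le le_rfl]; simp [h1]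
    ext i
    simp [Polynomial.reverse, h3, Polynomial.coeff_reflect]
  · intro g hg; rfl

theorem card_VF (n : ℕ) : (VF k n).card = Nat.card k ^ n := by
  classical
  have h1 : Nat.card (Polynomial.degreeLT k n) = Nat.card k ^ n := by
    rw [Nat.card_congr (Polynomial.degreeLTEquiv k n).toEquiv, Nat.card_fun]; simp
  have h2 : (VF k n).card = Nat.card (VF k n) := by simp
  rw [← h1, h2]
  symm
  refine Nat.card_congr (Equiv.ofBijective (fun g => ⟨1 + Polynomial.X * g.1, ?_⟩) ⟨?_, ?_⟩)
  · rw [mem_VF]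
    have := Polynomial.mem_degreeLT.1 g.2
    refine ⟨by simp, ?_⟩
    rcases eq_or_ne g.1 0 with h | h
    · simp [h]
    · have h3 := (Polynomial.natDegree_lt_iff_degree_lt h).2 this
      refine (Polynomial.natDegree_add_le _ _).trans (max_le (by simp) ?_)
      rw [Polynomial.natDegree_X_mul h]; omega
  · intro g g' h
    simp only [Subtype.mk.injEq, add_right_inj] at h
    exact Subtype.ext (mul_left_cancel₀ Polynomial.X_ne_zero h)
  · rintro ⟨u, hu⟩
    obtain ⟨u1, u2⟩ := mem_VF.1 hu
    refine ⟨⟨u.divX, ?_⟩, ?_⟩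
    · rw [Polynomial.mem_degreeLT]
      rcases eq_or_ne u.divX 0 with h | h
      · rw [h, Polynomial.degree_zero]; exact WithBot.bot_lt_coe _
      · rw [← Polynomial.natDegree_lt_iff_degree_lt h, Polynomial.natDegree_divX_eq_natDegree_tsub_one]
        have : u.natDegree ≠ 0 := by
          intro h0; apply h; rw [Polynomial.eq_C_of_natDegree_eq_zero h0]; simp
        omega
    · apply Subtype.ext
      have := Polynomial.X_mul_divX_add u
      rw [u1, map_one] at this
      simp only
      rw [add_comm]; exact this

/-- translation trick -/
theorem sum_zero_of_shift {ι : Type*} (s : Finset ι) (F : ι → ℂ) (T T' : ι → ι) (c : ℂ) (hc : c ≠ 1)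
    (hT : ∀ i ∈ s, T i ∈ s) (hT' : ∀ i ∈ s, T' i ∈ s) (h1 : ∀ i ∈ s, T' (T i) = i) (h2 : ∀ i ∈ s, T (T' i) = i)
    (hF : ∀ i ∈ s, F (T i) = c * F i) : ∑ i ∈ s, F i = 0 := by
  have : ∑ i ∈ s, c * F i = ∑ i ∈ s, F i :=
    Finset.sum_bij' (fun i _ => T i) (fun i _ => T' i) hT hT' h1 h2 (fun i hi => (hF i hi).symm)
  rw [← Finset.mul_sum] at this
  have h : (c - 1) * ∑ i ∈ s, F i = 0 := by rw [sub_mul, this]; ring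
  exact (mul_eq_zero.1 h).resolve_left (sub_ne_zero.2 hc)

theorem exists_shift (ψ : AddChar k ℂ) (hψ : ψ ≠ 1) (c : k) (hc : c ≠ 0) : ∃ e : k, ψ (c * e) ≠ 1 := by
  obtain ⟨a, ha⟩ := AddChar.ne_one_iff.1 hψ
  exact ⟨c⁻¹ * a, by rwa [mul_inv_cancel_left₀ hc]⟩


theorem Msum_zero (ψ : AddChar k ℂ) (hψ : ψ ≠ 1) (f : Polynomial k) (hd : (f.natDegree : k) ≠ 0)
    (n : ℕ) (hn : f.natDegree ≤ n) : Msum ψ f n = 0 := by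
  have hd1 : 1 ≤ f.natDegree := by
    rcases Nat.eq_zero_or_pos f.natDegree with h | h
    · rw [h] at hd; simp at hd
    · exact h
  have hf0 : f.leadingCoeff ≠ 0 := by
    rw [Ne, Polynomial.leadingCoeff_eq_zero]; rintro rfl; simp at hd1
  rw [Msum_eq]
  obtain ⟨e, he⟩ := exists_shift ψ hψ (-(f.natDegree * f.leadingCoeff)) (neg_ne_zero.2 (mul_ne_zero hd hf0))
  have hmem : ∀ e : k, ∀ u ∈ VF k n, u + Polynomial.monomial f.natDegree e ∈ VF k n := by
    intro e u hu
    obtain ⟨h1, h2⟩ := mem_VF.1 hu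
    refine mem_VF.2 ⟨?_, ?_⟩
    · rw [Polynomial.coeff_add, h1, Polynomial.coeff_monomial, if_neg (by omega), add_zero]
    · exact (Polynomial.natDegree_add_le _ _).trans (max_le h2 ((Polynomial.natDegree_monomial_le _).trans hn))
  refine sum_zero_of_shift _ _ (fun u => u + Polynomial.monomial f.natDegree e)
    (fun u => u + Polynomial.monomial f.natDegree (-e)) _ he (hmem e) (hmem (-e)) ?_ ?_ ?_
  · intro u _; simp [add_assoc, ← map_add]
  · intro u _; simp [add_assoc, ← map_add]
  · intro u hu
    have h1 := (mem_VF.1 hu).1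
    have h2 : ((u + Polynomial.monomial f.natDegree e : Polynomial k) : k⟦X⟧) = (u : k⟦X⟧) + X ^ f.natDegree * C e := by
      rw [← Polynomial.C_mul_X_pow_eq_monomial, Polynomial.coe_add, Polynomial.coe_mul, Polynomial.coe_pow,
        Polynomial.coe_C, Polynomial.coe_X, mul_comm]
    rw [chi, h2, lam_perturb f hd1 _ _ (by simpa using h1), sub_eq_add_neg, AddChar.map_add_eq_mul, chi, mul_comm]
    congr 2
    simp

/-- the Gauss sum -/
theorem Msum_top (ψ : AddChar k ℂ) (hψ : ψ ≠ 1) (f : Polynomial k) (hd : (f.natDegree : k) ≠ 0) :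
    Msum ψ f (f.natDegree - 1) * starRingEnd ℂ (Msum ψ f (f.natDegree - 1)) =
    (Nat.card k : ℂ) ^ (f.natDegree - 1) := by
  classical
  have hd1 : 1 ≤ f.natDegree := by
    rcases Nat.eq_zero_or_pos f.natDegree with h | h
    · rw [h] at hd; simp at hd
    · exact h
  have hf0 : f.leadingCoeff ≠ 0 := by
    rw [Ne, Polynomial.leadingCoeff_eq_zero]; rintro rfl; simp at hd1
  set d := f.natDegree with hdd
  set A : k := d * f.leadingCoeff with hA
  have hA0 : A ≠ 0 := mul_ne_zero hd hf0
  have hXm : (Polynomial.X ^ d : Polynomial k).Monic := Polynomial.monic_X_pow d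
  -- remainder facts
  have hrem : ∀ v ∈ VF k (d-1), ∀ w ∈ VF k (d-1), (v * w) %ₘ (Polynomial.X ^ d) ∈ VF k (d-1) ∧
      chi ψ f ((v * w) %ₘ (Polynomial.X ^ d)) = chi ψ f v * chi ψ f w * ψ (A * (v * w).coeff d) := by
    intro v hv w hw
    obtain ⟨v1, v2⟩ := mem_VF.1 hv
    obtain ⟨w1, w2⟩ := mem_VF.1 hw
    set r := (v * w) %ₘ (Polynomial.X ^ d) with hr
    set g := (v * w) /ₘ (Polynomial.X ^ d) with hg
    have h := Polynomial.modByMonic_add_div (v * w) (Polynomial.X ^ d)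
    rw [← hr, ← hg] at h
    have hrd : r.natDegree < d := by
      have := Polynomial.natDegree_modByMonic_lt (v * w) hXm (by
        intro h; have := congrArg Polynomial.natDegree h; simp at this; omega)
      simpa using this
    have hr0 : r.coeff 0 = 1 := by
      have h0 := congrArg (fun P => Polynomial.coeff P 0) h
      simp only [Polynomial.coeff_add, Polynomial.mul_coeff_zero, Polynomial.coeff_X_pow, v1, w1] at h0
      rw [if_neg (by omega)] at h0
      simpa using h0
    have hg0 : g.coeff 0 = (v * w).coeff d := by
      have h0 := congrArg (fun P => Polynomial.coeff P d) h
      simp only [Polynomial.coeff_add] at h0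
      rw [Polynomial.coeff_eq_zero_of_natDegree_lt hrd, Polynomial.coeff_X_pow_mul', if_pos le_rfl] at h0
      simpa using h0
    refine ⟨mem_VF.2 ⟨hr0, by omega⟩, ?_⟩
    have h3 : lam f ((v : k⟦X⟧) * (w : k⟦X⟧)) = lam f (r : k⟦X⟧) - A * (v * w).coeff d := by
      rw [← Polynomial.coe_mul, ← h, Polynomial.coe_add, Polynomial.coe_mul, Polynomial.coe_pow, Polynomial.coe_X,
        lam_perturb f hd1 _ _ (by simpa using hr0), h]
      congr 2

    rw [lam_mul _ _ _ (by simp [v1]) (by simp [w1])] at h3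
    rw [chi, chi, chi, ← AddChar.map_add_eq_mul, ← AddChar.map_add_eq_mul, h3]
    congr 1; ring
  have hinj : ∀ v ∈ VF k (d-1), Set.InjOn (fun w => (v * w) %ₘ (Polynomial.X ^ d)) (VF k (d-1)) := by
    intro v hv w hw w' hw' hww
    obtain ⟨v1, v2⟩ := mem_VF.1 hv
    obtain ⟨w1, w2⟩ := mem_VF.1 (Finset.mem_coe.1 hw)
    obtain ⟨w1', w2'⟩ := mem_VF.1 (Finset.mem_coe.1 hw')
    have h1 : Polynomial.X ^ d ∣ v * (w - w') := by
      rw [← Polynomial.modByMonic_eq_zero_iff_dvd hXm, mul_sub, Polynomial.sub_modByMonic]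
      exact sub_eq_zero.2 hww
    have h2 := Polynomial.prime_X.pow_dvd_of_dvd_mul_left d (by rw [Polynomial.X_dvd_iff, v1]; exact one_ne_zero) h1
    refine sub_eq_zero.1 (Polynomial.eq_zero_of_dvd_of_natDegree_lt h2 ?_)
    rw [Polynomial.natDegree_X_pow]
    have := Polynomial.natDegree_sub_le w w'
    have := max_le w2 w2'
    omega
  have hbij : ∀ v ∈ VF k (d-1), ∑ w ∈ VF k (d-1), chi ψ f ((v * w) %ₘ (Polynomial.X ^ d)) = ∑ w ∈ VF k (d-1), chi ψ f w := by
    intro v hv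
    refine Finset.sum_nbij (fun w => (v * w) %ₘ (Polynomial.X ^ d)) (fun w hw => (hrem v hv w hw).1) (hinj v hv) ?_
      (fun _ _ => rfl)
    exact Finset.surjOn_of_injOn_of_card_le _ (fun w hw => (hrem v hv w hw).1) (hinj v hv) le_rfl
  have hchi1 : ∀ v, starRingEnd ℂ (chi ψ f v) * chi ψ f v = 1 := by
    intro v
    rw [mul_comm, Complex.mul_conj, Complex.normSq_eq_norm_sq, chi, AddChar.norm_apply]; simp
  rw [Msum_eq, mul_comm, map_sum, Finset.sum_mul]
  have hstep : ∀ v ∈ VF k (d-1), starRingEnd ℂ (chi ψ f v) * ∑ w ∈ VF k (d-1), chi ψ f w =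
      ∑ w ∈ VF k (d-1), chi ψ f w * ψ (A * (v * w).coeff d) := by
    intro v hv
    rw [← hbij v hv, Finset.mul_sum]
    refine Finset.sum_congr rfl fun w hw => ?_
    rw [(hrem v hv w hw).2]
    linear_combination (chi ψ f w * ψ (A * (v * w).coeff d)) * hchi1 v
  rw [Finset.sum_congr rfl hstep, Finset.sum_comm]
  have h1mem : (1 : Polynomial k) ∈ VF k (d-1) := mem_VF.2 (by simp)
  rw [Finset.sum_eq_single_of_mem 1 h1mem]
  · have h1 : ∀ v ∈ VF k (d-1), chi ψ f 1 * ψ (A * (v * 1).coeff d) = 1 := by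
      intro v hv
      obtain ⟨v1, v2⟩ := mem_VF.1 hv
      rw [mul_one, Polynomial.coeff_eq_zero_of_natDegree_lt (by omega), chi, Polynomial.coe_one, lam_one]
      simp
    rw [Finset.sum_congr rfl h1, Finset.sum_const, nsmul_eq_mul, mul_one, card_VF]
    push_cast; rfl
  · intro w hw hw1
    obtain ⟨w1, w2⟩ := mem_VF.1 hw
    rw [← Finset.mul_sum]
    obtain ⟨i, hi⟩ : ∃ i, w.coeff i ≠ (1 : Polynomial k).coeff i := by
      by_contra! h; exact hw1 (Polynomial.ext h)
    have hi0 : i ≠ 0 := by rintro rfl; simp [w1] at hi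
    rw [Polynomial.coeff_one, if_neg hi0] at hi
    have hid : i ≤ d - 1 := (Polynomial.le_natDegree_of_ne_zero hi).trans w2
    obtain ⟨e, he⟩ := exists_shift ψ hψ (A * w.coeff i) (mul_ne_zero hA0 hi)
    have hmem : ∀ e : k, ∀ u ∈ VF k (d-1), u + Polynomial.monomial (d - i) e ∈ VF k (d-1) := by
      intro e u hu
      obtain ⟨h1, h2⟩ := mem_VF.1 hu
      refine mem_VF.2 ⟨?_, ?_⟩
      · rw [Polynomial.coeff_add, h1, Polynomial.coeff_monomial, if_neg (by omega), add_zero]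
      · exact (Polynomial.natDegree_add_le _ _).trans (max_le h2 ((Polynomial.natDegree_monomial_le _).trans (by omega)))
    rw [sum_zero_of_shift _ (fun v => ψ (A * (v * w).coeff d)) (fun u => u + Polynomial.monomial (d - i) e)
      (fun u => u + Polynomial.monomial (d - i) (-e)) _ he (hmem e) (hmem (-e)), mul_zero]
    · intro u _; simp [add_assoc, ← map_add]
    · intro u _; simp [add_assoc, ← map_add]
    · intro u hu
      have h5 : (Polynomial.monomial (d - i) e * w).coeff d = e * w.coeff i := by
        rw [← Polynomial.C_mul_X_pow_eq_monomial, mul_assoc, Polynomial.coeff_C_mul, Polynomial.coeff_X_pow_mul',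
          if_pos (by omega)]
        congr 2; omega
      beta_reduce
      rw [add_mul, Polynomial.coeff_add, h5, ← AddChar.map_add_eq_mul]
      congr 1; ring
end
end PartB2

section PartB3
open PowerSeries

section
variable {k : Type*} [Field k] [Finite k]

variable (k) in
noncomputable def IR (n : ℕ) : Finset (Polynomial k) :=
  ((finite_natDegree_le n).subset (s := {g : Polynomial k | g.natDegree ≤ n})
    (t := {g : Polynomial k | (g.Monic ∧ Irreducible g) ∧ g.natDegree ≤ n}) (fun _ h => h.2)).toFinset

theorem mem_IR {n : ℕ} {g : Polynomial k} : g ∈ IR k n ↔ (g.Monic ∧ Irreducible g) ∧ g.natDegree ≤ n := by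
  simp [IR]

open UniqueFactorizationMonoid Classical in
theorem natDegree_eq_IR (n : ℕ) (g : Polynomial k) (hg : g ∈ monF k n) :
    n = ∑ P ∈ IR k n, ∑ a ∈ Finset.Icc 1 n, if P ^ a ∣ g then P.natDegree else 0 := by
  obtain ⟨h1, h2⟩ := mem_monF.1 hg
  have hg0 := h1.ne_zero
  have hmon : ∀ P ∈ normalizedFactors g, P.Monic ∧ Irreducible P ∧ P ∣ g := by
    intro P hP
    have hi := irreducible_of_normalized_factor P hP
    refine ⟨?_, hi, dvd_of_mem_normalizedFactors hP⟩
    have := normalize_normalized_factor P hP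
    rw [← this]; exact Polynomial.monic_normalize hi.ne_zero
  have hprod : (normalizedFactors g).prod = g := by
    have := prod_normalizedFactors_eq hg0
    rw [this, h1.normalize_eq_self]
  have hdeg : g.natDegree = ((normalizedFactors g).map Polynomial.natDegree).sum := by
    conv_lhs => rw [← hprod]
    exact Polynomial.natDegree_multiset_prod_of_monic _ (fun P hP => (hmon P hP).1)
  rw [Finset.sum_multiset_map_count, h2] at hdeg
  rw [Finset.sum_subset (s₂ := IR k n)] at hdeg
  · rw [hdeg]
    conv_rhs => rw [← hdeg]
    refine Finset.sum_congr rfl fun P hP => ?_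
    obtain ⟨⟨p1, p2⟩, p3⟩ := mem_IR.1 hP
    rw [← Finset.sum_filter, Finset.sum_const]
    congr 1
    have hcnt := emultiplicity_eq_count_normalizedFactors p2 hg0
    rw [p1.normalize_eq_self] at hcnt
    have hpd : ∀ a, P ^ a ∣ g ↔ a ≤ Multiset.count P (normalizedFactors g) := by
      intro a
      rw [pow_dvd_iff_le_emultiplicity, hcnt, Nat.cast_le]
    have hle : Multiset.count P (normalizedFactors g) ≤ n := by
      have h3 := (hpd _).2 le_rfl
      have h4 := Polynomial.natDegree_le_of_dvd h3 hg0
      rw [Polynomial.natDegree_pow, h2] at h4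
      have := p2.natDegree_pos
      nlinarith
    have : Finset.filter (fun a => P ^ a ∣ g) (Finset.Icc 1 n) = Finset.Icc 1 (Multiset.count P (normalizedFactors g)) := by
      ext a; simp only [Finset.mem_filter, Finset.mem_Icc, hpd]; omega
    rw [this]; simp
  · intro P hP
    obtain ⟨p1, p2, p3⟩ := hmon P (Multiset.mem_toFinset.1 hP)
    exact mem_IR.2 ⟨⟨p1, p2⟩, h2 ▸ Polynomial.natDegree_le_of_dvd p3 hg0⟩
  · intro P _ hP
    rw [Multiset.mem_toFinset, ← Multiset.count_eq_zero] at hP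
    rw [hP, zero_smul]

theorem chi_mul (ψ : AddChar k ℂ) (f g h : Polynomial k) (hg : g.Monic) (hh : h.Monic) :
    chi ψ f (g * h).reverse = chi ψ f g.reverse * chi ψ f h.reverse := by
  rw [chi, Polynomial.reverse_mul_of_domain, Polynomial.coe_mul, lam_mul _ _ _ (by simp [hg]) (by simp [hh]),
    AddChar.map_add_eq_mul]; rfl

theorem chi_pow (ψ : AddChar k ℂ) (f g : Polynomial k) (hg : g.Monic) (a : ℕ) :
    chi ψ f (g ^ a).reverse = chi ψ f g.reverse ^ a := by
  induction a with
  | zero =>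
    have : (1 : Polynomial k).reverse = 1 := by simpa using Polynomial.reverse_C (1 : k)
    rw [pow_zero, pow_zero, this, chi, Polynomial.coe_one, lam_one, AddChar.map_zero_eq_one]
  | succ a ih => rw [pow_succ, pow_succ, chi_mul _ _ _ _ (hg.pow a) hg, ih]

noncomputable def Ssum (ψ : AddChar k ℂ) (f : Polynomial k) (i : ℕ) : ℂ :=
  ∑ P ∈ IR k i with P.natDegree ∣ i, P.natDegree * chi ψ f P.reverse ^ (i / P.natDegree)

theorem Msum_nonempty_zero (ψ : AddChar k ℂ) (f : Polynomial k) : Msum ψ f 0 = 1 := by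
  have : monF k 0 = {1} := by
    ext g
    rw [mem_monF, Finset.mem_singleton]
    constructor
    · rintro ⟨h1, h2⟩; exact h1.natDegree_eq_zero.1 h2
    · rintro rfl; simp
  have h1 : (1 : Polynomial k).reverse = 1 := by simpa using Polynomial.reverse_C (1 : k)
  rw [Msum, this, Finset.sum_singleton, h1, chi, Polynomial.coe_one, lam_one, AddChar.map_zero_eq_one]

theorem Msum_rec (ψ : AddChar k ℂ) (f : Polynomial k) (n : ℕ) :
    (n : ℂ) * Msum ψ f n = ∑ i ∈ Finset.Icc 1 n, Ssum ψ f i * Msum ψ f (n - i) := by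
  classical
  have hdiv : ∀ P ∈ IR k n, ∀ a ∈ Finset.Icc 1 n, ∑ g ∈ monF k n, (if P ^ a ∣ g then chi ψ f g.reverse else 0) =
      if a * P.natDegree ≤ n then chi ψ f P.reverse ^ a * Msum ψ f (n - a * P.natDegree) else 0 := by
    intro P hP a ha
    obtain ⟨⟨p1, p2⟩, p3⟩ := mem_IR.1 hP
    have hPa : (P ^ a).Monic := p1.pow a
    rw [← Finset.sum_filter]
    split_ifs with h
    · rw [Msum, Finset.mul_sum]
      symm
      refine Finset.sum_bij (fun h _ => P ^ a * h) ?_ ?_ ?_ ?_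
      · intro u hu
        obtain ⟨u1, u2⟩ := mem_monF.1 hu
        rw [Finset.mem_filter, mem_monF]
        refine ⟨⟨hPa.mul u1, ?_⟩, dvd_mul_right _ _⟩
        rw [hPa.natDegree_mul u1, p1.natDegree_pow, u2]; omega
      · intro u _ u' _ huu
        exact mul_left_cancel₀ hPa.ne_zero huu
      · intro g hg
        rw [Finset.mem_filter, mem_monF] at hg
        obtain ⟨⟨g1, g2⟩, u, hu⟩ := hg
        have u1 : u.Monic := hPa.of_mul_monic_left (hu ▸ g1)
        refine ⟨u, mem_monF.2 ⟨u1, ?_⟩, hu.symm⟩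
        rw [hu, hPa.natDegree_mul u1, p1.natDegree_pow] at g2; omega
      · intro u hu
        rw [chi_mul _ _ _ _ hPa (mem_monF.1 hu).1, chi_pow _ _ _ p1]
    · apply Finset.sum_eq_zero
      intro g hg
      rw [Finset.mem_filter, mem_monF] at hg
      obtain ⟨⟨g1, g2⟩, hu⟩ := hg
      have := Polynomial.natDegree_le_of_dvd hu g1.ne_zero
      rw [p1.natDegree_pow] at this; omega
  have h1 : (n : ℂ) * Msum ψ f n = ∑ P ∈ IR k n, ∑ a ∈ Finset.Icc 1 n, (P.natDegree : ℂ) *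
      (if a * P.natDegree ≤ n then chi ψ f P.reverse ^ a * Msum ψ f (n - a * P.natDegree) else 0) := by
    rw [Msum, Finset.mul_sum]
    have : ∀ g ∈ monF k n, (n : ℂ) * chi ψ f g.reverse = ∑ P ∈ IR k n, ∑ a ∈ Finset.Icc 1 n,
        (P.natDegree : ℂ) * (if P ^ a ∣ g then chi ψ f g.reverse else 0) := by
      intro g hg
      conv_lhs => rw [natDegree_eq_IR n g hg]
      push_cast
      rw [Finset.sum_mul]
      refine Finset.sum_congr rfl fun P _ => ?_
      rw [Finset.sum_mul]
      refine Finset.sum_congr rfl fun a _ => ?_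
      split_ifs <;> simp
    rw [Finset.sum_congr rfl this, Finset.sum_comm]
    refine Finset.sum_congr rfl fun P hP => ?_
    rw [Finset.sum_comm]
    refine Finset.sum_congr rfl fun a ha => ?_
    rw [← Finset.mul_sum, hdiv P hP a ha]
  have h2 : ∀ i ∈ Finset.Icc 1 n, Ssum ψ f i * Msum ψ f (n - i) = ∑ P ∈ IR k n,
      if P.natDegree ∣ i then (P.natDegree : ℂ) * (chi ψ f P.reverse ^ (i / P.natDegree) * Msum ψ f (n - i)) else 0 := by
    intro i hi
    rw [Finset.mem_Icc] at hi
    rw [Ssum, Finset.sum_mul, ← Finset.sum_filter]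
    refine Finset.sum_congr ?_ (fun P _ => by ring)
    ext P
    simp only [Finset.mem_filter, mem_IR]
    constructor
    · rintro ⟨⟨h1, h2⟩, h3⟩; exact ⟨⟨h1, by omega⟩, h3⟩
    · rintro ⟨⟨h1, h2⟩, h3⟩; exact ⟨⟨h1, Nat.le_of_dvd (by omega) h3⟩, h3⟩
  rw [h1, Finset.sum_congr rfl h2]
  conv_rhs => rw [Finset.sum_comm]
  refine Finset.sum_congr rfl fun P hP => ?_
  obtain ⟨⟨p1, p2⟩, p3⟩ := mem_IR.1 hP
  have hpos := p2.natDegree_pos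
  simp only [mul_ite, mul_zero]
  rw [← Finset.sum_filter, ← Finset.sum_filter]
  refine Finset.sum_bij' (fun a _ => a * P.natDegree) (fun i _ => i / P.natDegree) ?_ ?_ ?_ ?_ ?_
  · intro a ha
    simp only [Finset.mem_filter, Finset.mem_Icc] at ha ⊢
    exact ⟨⟨by nlinarith, ha.2⟩, dvd_mul_left _ _⟩
  · intro i hi
    simp only [Finset.mem_filter, Finset.mem_Icc] at hi ⊢
    obtain ⟨⟨h1, h2⟩, c, rfl⟩ := hi
    rw [Nat.mul_div_cancel_left _ hpos]
    refine ⟨⟨?_, by nlinarith⟩, by nlinarith⟩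
    rcases Nat.eq_zero_or_pos c with h | h
    · subst h; simp at h1
    · exact h
  · intro a ha; exact Nat.mul_div_cancel _ hpos
  · intro i hi
    simp only [Finset.mem_filter] at hi
    exact Nat.div_mul_cancel hi.2
  · intro a ha
    rw [Nat.mul_div_cancel _ hpos]
end
end PartB3

section PartB4
open Polynomial

theorem newton_roots (D : ℕ) (M S : ℕ → ℂ) (hM0 : M 0 = 1) (hMz : ∀ n, D < n → M n = 0)
    (hrec : ∀ n : ℕ, (n : ℂ) * M n = ∑ i ∈ Finset.Icc 1 n, S i * M (n - i))
    (hintg : ∀ n, IsIntegral ℤ (M n)) :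
    ∃ ω : Fin D → ℂ, (∀ n, 1 ≤ n → S n = - ∑ i, ω i ^ n) ∧ (∏ i, ω i = (-1) ^ D * M D) ∧
      ∀ i, IsIntegral ℤ (ω i) := by
  set R : ℂ[X] := ∑ n ∈ Finset.range (D + 1), C (M n) * X ^ (D - n) with hR
  have hcoeff : ∀ n ≤ D, R.coeff (D - n) = M n := by
    intro n hn
    rw [hR, finset_sum_coeff, Finset.sum_eq_single n]
    · simp
    · intro b hb hbn
      rw [Finset.mem_range] at hb
      rw [coeff_C_mul, coeff_X_pow, if_neg (by omega), mul_zero]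
    · intro h; exact absurd (Finset.mem_range.2 (by omega)) h
  have hdeg : R.natDegree ≤ D := by
    refine natDegree_sum_le_of_forall_le _ _ fun i _ => ?_
    exact (natDegree_C_mul_X_pow_le _ _).trans (Nat.sub_le _ _)
  have hlead : R.coeff D = 1 := by simpa [hM0] using hcoeff 0 (Nat.zero_le _)
  have hmonic : R.Monic := monic_of_natDegree_le_of_coeff_eq_one _ hdeg hlead
  have hnat : R.natDegree = D := le_antisymm hdeg (le_natDegree_of_ne_zero (by rw [hlead]; exact one_ne_zero))
  have hcard : R.roots.card = R.natDegree := (IsAlgClosed.splits R).natDegree_eq_card_roots.symm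
  obtain ⟨ω, hω⟩ : ∃ ω : Fin D → ℂ, (Finset.univ.val.map ω) = R.roots := by
    have hl : R.roots.toList.length = D := by rw [Multiset.length_toList, hcard, hnat]
    refine ⟨fun i => R.roots.toList.get (Fin.cast hl.symm i), ?_⟩
    have : (List.ofFn fun i => R.roots.toList.get (Fin.cast hl.symm i)) = R.roots.toList := by
      apply List.ext_get
      · simp [hl]
      · intro n h1 h2; simp
    conv_rhs => rw [← Multiset.coe_toList R.roots, ← this]
    rw [List.ofFn_eq_map]
    rfl
  have hes : ∀ n ≤ D, M n = (-1) ^ n * (Finset.univ.val.map ω).esymm n := by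
    intro n hn
    rw [hω, ← hcoeff n hn, coeff_eq_esymm_roots_of_card hcard (by omega), hmonic.leadingCoeff, hnat]
    have : D - (D - n) = n := by omega
    rw [this, one_mul]
  have hes2 : ∀ n, M n = (-1) ^ n * MvPolynomial.aeval ω (MvPolynomial.esymm (Fin D) ℂ n) := by
    intro n
    by_cases hn : n ≤ D
    · rw [hes n hn, MvPolynomial.aeval_esymm_eq_multiset_esymm]
    · rw [MvPolynomial.esymm, Finset.powersetCard_eq_empty.2 (by simp; omega), Finset.sum_empty, map_zero, mul_zero, hMz n (by omega)]
  have hnewton : ∀ n : ℕ, (n : ℂ) * M n = - ∑ i ∈ Finset.Icc 1 n, (∑ j, ω j ^ i) * M (n - i) := by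
    intro n
    have h := congrArg (MvPolynomial.aeval ω) (MvPolynomial.mul_esymm_eq_sum (Fin D) ℂ n)
    simp only [map_mul, map_natCast, map_sum, map_pow, map_neg, map_one, MvPolynomial.psum, MvPolynomial.aeval_X] at h
    rw [hes2 n, mul_left_comm, h, ← mul_assoc, ← pow_add, Odd.neg_one_pow ⟨n, by ring⟩, neg_one_mul]
    congr 1
    refine Finset.sum_bij' (fun a _ => a.2) (fun i _ => (n - i, i)) ?_ ?_ ?_ ?_ ?_
    · rintro ⟨x, y⟩ h; simp only [Finset.mem_filter, Finset.HasAntidiagonal.mem_antidiagonal, Finset.mem_Icc] at h ⊢; omega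
    · intro i hi; simp only [Finset.mem_filter, Finset.HasAntidiagonal.mem_antidiagonal, Finset.mem_Icc] at hi ⊢; omega
    · rintro ⟨x, y⟩ h
      simp only [Finset.mem_filter, Finset.HasAntidiagonal.mem_antidiagonal] at h ⊢
      rw [Prod.mk.injEq]; omega
    · intro i hi; rfl
    · rintro ⟨x, y⟩ h
      simp only [Finset.mem_filter, Finset.HasAntidiagonal.mem_antidiagonal] at h
      have : n - y = x := by omega
      simp only
      rw [this, hes2 x]; ring
  refine ⟨ω, ?_, ?_, ?_⟩
  · intro n
    induction n using Nat.strong_induction_on with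
    | _ n ih =>
      intro hn
      have h1 := hrec n
      rw [hnewton n, ← Finset.sum_neg_distrib] at h1
      obtain ⟨m, rfl⟩ : ∃ m, n = m + 1 := ⟨n - 1, by omega⟩
      rw [Finset.sum_Icc_succ_top (by omega), Finset.sum_Icc_succ_top (by omega), Nat.sub_self, hM0] at h1
      have h2 : ∑ i ∈ Finset.Icc 1 m, S i * M (m + 1 - i) = ∑ i ∈ Finset.Icc 1 m, -((∑ j, ω j ^ i) * M (m + 1 - i)) := by
        refine Finset.sum_congr rfl fun i hi => ?_
        rw [Finset.mem_Icc] at hi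
        rw [ih i (by omega) hi.1]; ring
      rw [h2] at h1
      linear_combination -h1
  · have h := hes D le_rfl
    rw [h, ← mul_assoc, ← pow_add, Even.neg_one_pow ⟨D, rfl⟩, one_mul]
    have h2 := MvPolynomial.aeval_esymm_eq_multiset_esymm (Fin D) ℂ D ω
    have h3 : Finset.powersetCard D (Finset.univ : Finset (Fin D)) = {Finset.univ} := by
      simpa using Finset.powersetCard_self (Finset.univ : Finset (Fin D))
    rw [← h2, MvPolynomial.esymm, h3]; simp
  · intro i
    have hroot : R.IsRoot (ω i) := by
      apply isRoot_of_mem_roots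
      rw [← hω]; exact Multiset.mem_map_of_mem _ (Finset.mem_univ_val i)
    have : IsIntegral (integralClosure ℤ ℂ) (ω i) := by
      have hl : R ∈ lifts (algebraMap (integralClosure ℤ ℂ) ℂ) := by
        rw [lifts_iff_coeff_lifts]
        intro n
        by_cases hn : n ≤ D
        · have := hcoeff (D - n) (by omega)
          rw [show D - (D - n) = n by omega] at this
          rw [this]; exact ⟨⟨M (D - n), hintg _⟩, rfl⟩
        · rw [coeff_eq_zero_of_natDegree_lt (by omega)]; exact ⟨0, map_zero _⟩
      obtain ⟨R', h1, h2, h3⟩ := lifts_and_natDegree_eq_and_monic hl hmonic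
      refine ⟨R', h3, ?_⟩
      rw [← eval_map, h1]; exact hroot
    exact isIntegral_trans _ this
end PartB4

section PartC1
section
open PowerSeries
theorem lder_unique {k : Type*} [Field k] (u z : k⟦X⟧) (hu : constantCoeff u ≠ 0)
    (h : z * u = -(X * derivative k u)) : z = lder u := by
  have h1 := PowerSeries.mul_inv_cancel u hu
  rw [lder, ← neg_mul, ← h, mul_assoc, h1, mul_one]

theorem lder_spec {k : Type*} [Field k] (u : k⟦X⟧) (hu : constantCoeff u ≠ 0) :
    lder u * u = -(X * derivative k u) := by
  have h1 := PowerSeries.inv_mul_cancel u hu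
  rw [lder, neg_mul, mul_assoc, h1, mul_one]

theorem map_lder {k E : Type*} [Field k] [Field E] (φ : k →+* E) (u : k⟦X⟧) (hu : constantCoeff u ≠ 0) :
    PowerSeries.map φ (lder u) = lder (PowerSeries.map φ u) := by
  apply lder_unique
  · rw [← coeff_zero_eq_constantCoeff_apply, coeff_map, coeff_zero_eq_constantCoeff_apply]
    exact (map_ne_zero φ).2 hu
  · rw [← map_mul, lder_spec u hu, map_neg, map_mul, map_X]
    congr 2
    ext i
    simp [coeff_map, PowerSeries.coeff_derivative]

theorem coeff_lder_linear {E : Type*} [Field E] (α : E) (i : ℕ) (hi : 1 ≤ i) :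
    coeff i (lder (1 - C α * X : E⟦X⟧)) = α ^ i := by
  have : lder (1 - C α * X : E⟦X⟧) = mk (fun i => if i = 0 then 0 else α ^ i) := by
    symm
    apply lder_unique
    · simp
    · have h1 : derivative E (1 - C α * X : E⟦X⟧) = - C α := by
        simp [Derivation.leibniz]
      rw [h1]
      ext i
      rcases i with _ | _ | i
      · simp
      · rw [mul_sub, mul_one, ← mul_assoc, map_sub, coeff_succ_mul_X, mul_comm _ (C α), coeff_C_mul]
        simp
      · rw [mul_sub, mul_one, ← mul_assoc, map_sub, coeff_succ_mul_X, mul_comm _ (C α), coeff_C_mul]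
        simp [pow_succ, PowerSeries.coeff_C, PowerSeries.coeff_X]
        try ring
  rw [this, coeff_mk, if_neg (by omega)]

theorem coeff_lder_prod {E : Type*} [Field E] (s : Multiset E) (i : ℕ) (hi : 1 ≤ i) :
    coeff i (lder ((s.map (fun α => Polynomial.X - Polynomial.C α)).prod.reverse : E⟦X⟧)) =
    (s.map (fun α => α ^ i)).sum := by
  induction s using Multiset.induction_on with
  | empty =>
    have : (1 : Polynomial E).reverse = 1 := by simpa using Polynomial.reverse_C (1 : E)
    simp only [Multiset.map_zero, Multiset.prod_zero, Multiset.sum_zero, this, Polynomial.coe_one, lder_one, map_zero]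
  | cons a s ih =>
    have hrev : (Polynomial.X - Polynomial.C a).reverse = 1 - Polynomial.C a * Polynomial.X := by
      ext j
      rw [Polynomial.coeff_reverse, Polynomial.natDegree_X_sub_C, Polynomial.coeff_sub, Polynomial.coeff_sub,
        Polynomial.coeff_C_mul]
      rcases j with _ | _ | j
      · simp [Polynomial.coeff_C]
      · rw [Polynomial.revAt_le (by omega)]; simp [Polynomial.coeff_X, Polynomial.coeff_one]
      · rw [Polynomial.revAt_eq_self_of_lt (by omega)]; simp [Polynomial.coeff_X, Polynomial.coeff_one, Polynomial.coeff_C]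
    rw [Multiset.map_cons, Multiset.prod_cons, Polynomial.reverse_mul_of_domain, hrev, Polynomial.coe_mul, lder_mul,
      map_add, ih, Multiset.map_cons, Multiset.sum_cons]
    · congr 1
      rw [← coeff_lder_linear a i hi]; simp
    · simp
    · have : (s.map (fun α => Polynomial.X - Polynomial.C α)).prod.Monic :=
        Polynomial.monic_multiset_prod_of_monic _ _ (fun α _ => Polynomial.monic_X_sub_C α)
      simp [this]

theorem lam_roots {k E : Type*} [Field k] [Field E] [Algebra k E] (f P : Polynomial k) (hf0 : f.coeff 0 = 0)
    (hP : P.Monic) (hs : (P.map (algebraMap k E)).Splits) :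
    algebraMap k E (lam f (P.reverse : k⟦X⟧)) = ((P.aroots E).map (fun α => Polynomial.aeval α f)).sum := by
  have hmon : (P.map (algebraMap k E)).Monic := hP.map _
  have hrev : PowerSeries.map (algebraMap k E) (P.reverse : k⟦X⟧) = ((P.map (algebraMap k E)).reverse : E⟦X⟧) := by
    rw [← Polynomial.polynomial_map_coe, Polynomial.reverse, Polynomial.reverse, Polynomial.reflect_map,
      Polynomial.natDegree_map]
  have hprod : P.map (algebraMap k E) = ((P.aroots E).map (fun α => Polynomial.X - Polynomial.C α)).prod := by
    have := hs.eq_prod_roots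
    rw [hmon.leadingCoeff, Polynomial.C_1, one_mul] at this
    exact this
  have hc : ∀ i, 1 ≤ i → algebraMap k E (coeff i (lder (P.reverse : k⟦X⟧))) = ((P.aroots E).map (fun α => α ^ i)).sum := by
    intro i hi
    rw [← coeff_map, map_lder _ _ (by simp [hP]), hrev, hprod, coeff_lder_prod _ _ hi]
  have h1 : ∀ α : E, Polynomial.aeval α f = ∑ i ∈ Finset.range (f.natDegree + 1), algebraMap k E (f.coeff i) * α ^ i := by
    intro α
    rw [Polynomial.aeval_eq_sum_range]
    simp [Algebra.smul_def]
  simp only [h1]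
  rw [Multiset.sum_map_sum, lam, map_sum]
  refine Finset.sum_congr rfl fun i _ => ?_
  rw [map_mul, Multiset.sum_map_mul_left]
  rcases Nat.eq_zero_or_pos i with rfl | hi
  · simp [hf0]
  · rw [hc i hi]
end

section
open Polynomial IntermediateField
variable {k : Type*} [Field k] [Finite k] {K : Type*} [Field K] [Finite K] [Algebra k K]

theorem trace_lam (f : k[X]) (hf0 : f.coeff 0 = 0) (x : K) :
    Algebra.trace k K (aeval x f) =
      (Module.finrank k K / (minpoly k x).natDegree) • lam f ((minpoly k x).reverse : PowerSeries k) := by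
  classical
  have hx : IsIntegral k x := IsIntegral.of_finite k x
  set z : k⟮x⟯ := aeval (AdjoinSimple.gen k x) f with hz
  have h1 : aeval x f = algebraMap k⟮x⟯ K z := by
    rw [hz, ← aeval_algebraMap_apply, AdjoinSimple.algebraMap_gen]
  have hfr : Module.finrank k K / (minpoly k x).natDegree = Module.finrank k⟮x⟯ K := by
    rw [← Module.finrank_mul_finrank k k⟮x⟯ K, adjoin.finrank hx,
      Nat.mul_div_cancel_left _ (minpoly.natDegree_pos hx)]
  rw [hfr, ← Algebra.trace_trace (S := k⟮x⟯), h1, Algebra.trace_algebraMap, map_nsmul]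
  congr 1
  apply (algebraMap k (AlgebraicClosure k)).injective
  rw [lam_roots (E := AlgebraicClosure k) f _ hf0 (minpoly.monic hx) (IsAlgClosed.splits _),
    trace_eq_sum_embeddings (AlgebraicClosure k)]
  let pb := adjoin.powerBasis hx
  have hgen : pb.gen = AdjoinSimple.gen k x := adjoin.powerBasis_gen hx
  have hmp : minpoly k pb.gen = minpoly k x := by rw [hgen, minpoly_gen]
  have hnod : ((minpoly k pb.gen).aroots (AlgebraicClosure k)).Nodup := by
    apply nodup_roots
    rw [hmp]
    exact (separable_map _).2 (Algebra.IsSeparable.isSeparable k x)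
  rw [← hmp, Fintype.sum_equiv pb.liftEquiv' _ (fun y => aeval y.1 f), Finset.sum_mem_multiset (g := fun y => aeval y f),
    Finset.sum_eq_multiset_sum, Multiset.toFinset_val, Multiset.dedup_eq_self.mpr hnod]
  · intro x; rfl
  · intro σ
    rw [PowerBasis.liftEquiv'_apply_coe, hgen, hz, ← aeval_algHom_apply]

theorem sum_eq_Ssum [Fintype K] (ψ : AddChar k ℂ) (f : k[X]) (hf0 : f.coeff 0 = 0) :
    ∑ x : K, ψ (Algebra.trace k K (aeval x f)) = Ssum ψ f (Module.finrank k K) := by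
  classical
  set n := Module.finrank k K with hn
  have hintg : ∀ x : K, IsIntegral k x := fun x => IsIntegral.of_finite k x
  have hmaps : ∀ x ∈ (Finset.univ : Finset K), minpoly k x ∈ (IR k n).filter (fun P => P.natDegree ∣ n) := by
    intro x _
    have hdvd : (minpoly k x).natDegree ∣ n := minpoly.degree_dvd (hintg x)
    rw [Finset.mem_filter, mem_IR]
    exact ⟨⟨⟨minpoly.monic (hintg x), minpoly.irreducible (hintg x)⟩, Nat.le_of_dvd Module.finrank_pos hdvd⟩, hdvd⟩
  rw [← Finset.sum_fiberwise_of_maps_to hmaps, Ssum]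
  refine Finset.sum_congr rfl fun P hP => ?_
  rw [Finset.mem_filter, mem_IR] at hP
  obtain ⟨⟨⟨p1, p2⟩, p3⟩, p4⟩ := hP
  have hval : ∀ x ∈ Finset.univ.filter (fun x : K => minpoly k x = P), ψ (Algebra.trace k K (aeval x f)) =
      chi ψ f P.reverse ^ (n / P.natDegree) := by
    intro x hx
    rw [Finset.mem_filter] at hx
    rw [trace_lam f hf0 x, hx.2, AddChar.map_nsmul_eq_pow]; rfl
  rw [Finset.sum_congr rfl hval, Finset.sum_const, nsmul_eq_mul]
  congr 2
  obtain ⟨x, hx⟩ : ∃ x : K, minpoly k x = P := by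
    haveI : Fact (Irreducible P) := ⟨p2⟩
    have hfr : Module.finrank k (AdjoinRoot P) = P.natDegree := by
      rw [(AdjoinRoot.powerBasis p2.ne_zero).finrank, AdjoinRoot.powerBasis_dim]
    obtain ⟨φ⟩ := FiniteField.nonempty_algHom_of_finrank_dvd (F := k) (K := AdjoinRoot P) (L := K) (by rw [hfr]; exact p4)
    refine ⟨φ (AdjoinRoot.root P), ?_⟩
    rw [minpoly.algHom_eq φ φ.injective]
    exact (minpoly.eq_of_irreducible_of_monic p2 (by simp) p1).symm
  have hset : Finset.univ.filter (fun x : K => minpoly k x = P) = (P.aroots K).toFinset := by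
    ext y
    rw [Finset.mem_filter, Multiset.mem_toFinset, mem_aroots]
    constructor
    · rintro ⟨_, rfl⟩; exact ⟨p2.ne_zero, minpoly.aeval k y⟩
    · rintro ⟨_, h⟩; exact ⟨Finset.mem_univ _, (minpoly.eq_of_irreducible_of_monic p2 h p1).symm⟩
  rw [hset, Multiset.toFinset_card_of_nodup]
  · have hsp : (P.map (algebraMap k K)).Splits := by rw [← hx]; exact Normal.splits inferInstance x
    have := hsp.natDegree_eq_card_roots
    rw [natDegree_map] at this
    exact this.symm
  · apply nodup_roots
    rw [← hx]
    exact (separable_map _).2 (Algebra.IsSeparable.isSeparable k x)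
end
end PartC1

section PartC2
open Polynomial

theorem pow_bound (D : ℕ) (z : Fin D → ℂ) (Q C : ℝ) (hQ : 0 < Q) (J : ℕ)
    (h : ∀ j, J ≤ j → ‖∑ i, z i ^ j‖ ≤ C * Q ^ j) (i : Fin D) : ‖z i‖ ≤ Q := by
  classical
  set β := z i with hβ
  set T := (Finset.univ.image z).erase β with hT
  set g : ℂ[X] := ∏ b ∈ T, (X - Polynomial.C b) with hg
  have hg0 : ∀ i', z i' ≠ β → g.eval (z i') = 0 := by
    intro i' hi'
    rw [hg, eval_prod]
    apply Finset.prod_eq_zero (i := z i')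
    · rw [hT, Finset.mem_erase]; exact ⟨hi', Finset.mem_image_of_mem _ (Finset.mem_univ _)⟩
    · simp
  have hgβ : g.eval β ≠ 0 := by
    rw [hg, eval_prod, Finset.prod_ne_zero_iff]
    intro b hb
    rw [hT, Finset.mem_erase] at hb
    simp [sub_eq_zero, hb.1.symm]
  set m := (Finset.univ.filter (fun i' => z i' = β)).card with hm
  have hm1 : 1 ≤ m := Finset.card_pos.2 ⟨i, by simp [hβ]⟩
  have hsum : ∀ j, ∑ i', z i' ^ j * g.eval (z i') = m * (β ^ j * g.eval β) := by
    intro j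
    rw [← Finset.sum_filter_add_sum_filter_not _ (fun i' => z i' = β)]
    rw [Finset.sum_eq_zero (s := Finset.univ.filter (fun i' => ¬ z i' = β)), add_zero,
      Finset.sum_congr rfl (g := fun _ => β ^ j * g.eval β), Finset.sum_const, nsmul_eq_mul]
    · intro i' hi'; rw [(Finset.mem_filter.1 hi').2]
    · intro i' hi'; rw [hg0 i' (Finset.mem_filter.1 hi').2, mul_zero]
  have hsum2 : ∀ j, ∑ i', z i' ^ j * g.eval (z i') =
      ∑ l ∈ Finset.range (g.natDegree + 1), g.coeff l * ∑ i', z i' ^ (j + l) := by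
    intro j
    simp only [Finset.mul_sum]
    rw [Finset.sum_comm]
    refine Finset.sum_congr rfl fun i' _ => ?_
    rw [eval_eq_sum_range, Finset.mul_sum]
    refine Finset.sum_congr rfl fun l _ => ?_
    ring
  set B := ∑ l ∈ Finset.range (g.natDegree + 1), ‖g.coeff l‖ * (C * Q ^ l) with hB
  have hbd : ∀ j, J ≤ j → m * (‖β‖ ^ j * ‖g.eval β‖) ≤ B * Q ^ j := by
    intro j hj
    have h1 := (hsum j).symm.trans (hsum2 j)
    have h2 : ‖(m : ℂ) * (β ^ j * g.eval β)‖ = m * (‖β‖ ^ j * ‖g.eval β‖) := by simp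
    rw [← h2, h1, hB, Finset.sum_mul]
    refine (norm_sum_le _ _).trans (Finset.sum_le_sum fun l _ => ?_)
    rw [norm_mul, mul_assoc]
    gcongr
    refine (h (j + l) (by omega)).trans (le_of_eq ?_)
    ring
  by_contra! hlt
  have hr : 1 < ‖β‖ / Q := (one_lt_div hQ).2 hlt
  have hgpos : 0 < ‖g.eval β‖ := norm_pos_iff.2 hgβ
  obtain ⟨N, hN⟩ := pow_unbounded_of_one_lt (B / ‖g.eval β‖) hr
  have h1 : B / ‖g.eval β‖ < (‖β‖ / Q) ^ (N + J) := hN.trans_le (pow_le_pow_right₀ hr.le (by omega))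
  have h2 := hbd (N + J) (by omega)
  rw [div_pow, div_lt_div_iff₀ hgpos (by positivity)] at h1
  have h3 : ‖β‖ ^ (N + J) * ‖g.eval β‖ ≤ m * (‖β‖ ^ (N + J) * ‖g.eval β‖) := by
    apply le_mul_of_one_le_left (by positivity)
    exact_mod_cast hm1
  linarith

theorem eq_of_prod_eq (D : ℕ) (r : Fin D → ℝ) (Q : ℝ) (hQ : 0 < Q) (h0 : ∀ i, 0 ≤ r i) (h : ∀ i, r i ≤ Q)
    (hp : ∏ i, r i = Q ^ D) (i : Fin D) : r i = Q := by
  by_contra hne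
  have hlt := lt_of_le_of_ne (h i) hne
  have hpos : ∀ i, 0 < r i := by
    intro i'
    refine lt_of_le_of_ne (h0 i') fun h => ?_
    have : ∏ i, r i = 0 := Finset.prod_eq_zero (Finset.mem_univ i') h.symm
    rw [this] at hp
    exact absurd hp.symm (by positivity)
  have := Finset.prod_lt_prod (s := Finset.univ) (f := r) (g := fun _ => Q) (fun i _ => hpos i) (fun i _ => h i)
    ⟨i, Finset.mem_univ _, hlt⟩
  rw [hp] at this
  simp at this

theorem isIntegral_chi {k : Type*} [Field k] [Finite k] (p : ℕ) [Fact p.Prime] [CharP k p] (ψ : AddChar k ℂ) (a : k) :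
    IsIntegral ℤ (ψ a) := by
  have : (ψ a) ^ p = 1 := by
    rw [← AddChar.map_nsmul_eq_pow, nsmul_eq_mul, CharP.cast_eq_zero, zero_mul, AddChar.map_zero_eq_one]
  refine IsIntegral.of_pow (Fact.out : p.Prime).pos ?_
  rw [this]; exact isIntegral_one

theorem weil_roots {k : Type*} [Field k] [Fintype k] (p : ℕ) [Fact p.Prime] [CharP k p] [Algebra (ZMod p) k]
    (f : k[X]) (hd : ¬ p ∣ f.natDegree) (hf0 : f.coeff 0 = 0) (e : AddChar (ZMod p) ℂ) (he : e ≠ 1)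
    (ψ : AddChar k ℂ) (hψe : ∀ a, ψ a = e (Algebra.trace (ZMod p) k a)) :
    ∃ ω : Fin (f.natDegree - 1) → ℂ, (∀ n, 1 ≤ n → Ssum ψ f n = - ∑ i, ω i ^ n) ∧
      (∀ i, ω i * starRingEnd ℂ (ω i) = Fintype.card k) ∧ ∀ i, IsIntegral ℤ (ω i) := by
  have hp : p.Prime := Fact.out
  have hdk : (f.natDegree : k) ≠ 0 := by rwa [Ne, CharP.cast_eq_zero_iff k p]
  have hd1 : 1 ≤ f.natDegree := by
    rcases Nat.eq_zero_or_pos f.natDegree with h | h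
    · rw [h] at hd; simp at hd
    · exact h
  have hψ : ψ ≠ 1 := by
    obtain ⟨b, hb⟩ := AddChar.ne_one_iff.1 he
    obtain ⟨a, ha⟩ := Algebra.trace_surjective (ZMod p) k b
    rw [AddChar.ne_one_iff]
    exact ⟨a, by rw [hψe, ha]; exact hb⟩
  obtain ⟨ω, h1, h2, h3⟩ := newton_roots (f.natDegree - 1) (Msum ψ f) (Ssum ψ f) (Msum_nonempty_zero ψ f)
    (fun n hn => Msum_zero ψ hψ f hdk n (by omega)) (Msum_rec ψ f)
    (fun n => IsIntegral.sum _ fun g _ => isIntegral_chi p ψ _)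
  refine ⟨ω, h1, ?_, h3⟩
  set Q : ℕ := Fintype.card k with hQ
  obtain ⟨s0, hs0⟩ : ∃ s0, Q = p ^ s0 ∧ 1 ≤ s0 := by
    obtain ⟨n, hn1, hn2⟩ := FiniteField.card k p
    exact ⟨n, hn2, n.2⟩
  have hQpos : 0 < Q := Fintype.card_pos
  have hQ1 : 1 < Q := Fintype.one_lt_card
  have hbd : ∀ j, (f.natDegree * p + 1) ^ 2 ≤ j → ‖∑ i, (ω i ^ 2) ^ j‖ ≤ (p * (1 + 2 * f.natDegree * p) : ℕ) * (Q : ℝ) ^ j := by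
    intro j hj
    have hj1 : 1 ≤ j := le_trans (Nat.one_le_pow _ _ (by omega)) hj
    haveI : NeZero (2 * j) := ⟨by omega⟩
    let K := FiniteField.Extension k p (2 * j)
    haveI : Finite K := inferInstance
    letI : Fintype K := Fintype.ofFinite K
    haveI : CharP K p := charP_of_injective_algebraMap (algebraMap k K).injective p
    letI : Algebra (ZMod p) K := ZMod.algebra K p
    haveI : IsScalarTower (ZMod p) k K := by
      refine IsScalarTower.of_algebraMap_eq' ?_
      exact Subsingleton.elim _ _
    have hfr : Module.finrank k K = 2 * j := FiniteField.finrank_extension k p (2 * j)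
    have hcard : Fintype.card K = (Q ^ j) ^ 2 := by
      rw [Module.card_eq_pow_finrank (K := k), hfr, ← pow_mul, mul_comm 2 j]
    have hst := stepanov_sum (K := K) p f.natDegree (s0 * j) (Q ^ j) hd (by nlinarith) (by rw [hs0.1, pow_mul]) hcard
      (hj.trans (Nat.lt_pow_self hQ1).le) (f.map (algebraMap k K)) (natDegree_map _) e
      (fun a => le_of_eq (AddChar.norm_apply e a)) (AddChar.sum_eq_zero_of_ne_one he)
    have heq : ∑ x : K, e (Algebra.trace (ZMod p) K ((f.map (algebraMap k K)).eval x)) = Ssum ψ f (2 * j) := by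
      have h6 := sum_eq_Ssum (K := K) ψ f hf0
      rw [hfr] at h6
      rw [← h6]
      refine Finset.sum_congr rfl fun x _ => ?_
      rw [hψe, Algebra.trace_trace, eval_map_algebraMap]
    rw [heq, h1 _ (by omega), norm_neg] at hst
    simp only [← pow_mul]
    refine hst.trans (le_of_eq ?_)
    push_cast; ring
  have hle := fun i => pow_bound _ (fun i => ω i ^ 2) Q _ (by exact_mod_cast hQpos) _ hbd i
  have htop := Msum_top ψ hψ f hdk
  have hprod : ∏ i, ‖ω i ^ 2‖ = (Q : ℝ) ^ (f.natDegree - 1) := by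
    have h4 : ∏ i, ‖ω i ^ 2‖ = ‖∏ i, ω i‖ ^ 2 := by
      rw [norm_prod, ← Finset.prod_pow]; simp
    rw [h4, h2, norm_mul, norm_pow, norm_neg, norm_one, one_pow, one_mul]
    rw [Complex.mul_conj, Complex.normSq_eq_norm_sq, Nat.card_eq_fintype_card, ← hQ] at htop
    exact_mod_cast htop
  intro i
  have h5 := eq_of_prod_eq _ (fun i => ‖ω i ^ 2‖) Q (by exact_mod_cast hQpos) (fun i => norm_nonneg _) hle hprod i
  rw [Complex.mul_conj, Complex.normSq_eq_norm_sq]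
  rw [norm_pow] at h5
  exact_mod_cast h5
end PartC2

section PartC3
open Polynomial

theorem serre_bound {ι : Type*} [Fintype ι] (ω : ι → ℂ) (Q : ℕ) (hintg : ∀ i, IsIntegral ℤ (ω i))
    (hQ : ∀ i, ω i * starRingEnd ℂ (ω i) = Q)
    (hrat : ∀ n, 1 ≤ n → ∑ i, ω i ^ n ∈ (algebraMap ℚ ℂ).fieldRange) :
    2 * ∑ i, (ω i).re ≤ Fintype.card ι * (⌊2 * Real.sqrt Q⌋₊ : ℝ) := by
  classical
  set S := (algebraMap ℚ ℂ).fieldRange with hS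
  set fl : ℕ := ⌊2 * Real.sqrt Q⌋₊ with hfl
  have hnat : ∀ n : ℕ, (n : ℂ) ∈ S := fun n => natCast_mem S n
  have hconj : ∀ z ∈ S, starRingEnd ℂ z ∈ S := by
    rintro z ⟨r, rfl⟩
    refine ⟨r, ?_⟩
    simp
  have hrat0 : ∀ n, ∑ i, ω i ^ n ∈ S := by
    intro n
    rcases Nat.eq_zero_or_pos n with rfl | h
    · simpa using hnat (Fintype.card ι)
    · exact hrat n h
  have hab : ∀ a b : ℕ, ∑ i, ω i ^ a * starRingEnd ℂ (ω i) ^ b ∈ S := by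
    intro a b
    rcases le_total b a with h | h
    · obtain ⟨c, rfl⟩ := Nat.exists_eq_add_of_le h
      have : ∑ i, ω i ^ (b + c) * starRingEnd ℂ (ω i) ^ b = (Q : ℂ) ^ b * ∑ i, ω i ^ c := by
        rw [Finset.mul_sum]
        refine Finset.sum_congr rfl fun i _ => ?_
        rw [← hQ i, mul_pow]; ring
      rw [this]
      exact mul_mem (pow_mem (hnat Q) _) (hrat0 c)
    · obtain ⟨c, rfl⟩ := Nat.exists_eq_add_of_le h
      have : ∑ i, ω i ^ a * starRingEnd ℂ (ω i) ^ (a + c) = (Q : ℂ) ^ a * starRingEnd ℂ (∑ i, ω i ^ c) := by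
        rw [map_sum, Finset.mul_sum]
        refine Finset.sum_congr rfl fun i _ => ?_
        rw [← hQ i, mul_pow, map_pow]; ring
      rw [this]
      exact mul_mem (pow_mem (hnat Q) _) (hconj _ (hrat0 c))
  set θ : ι → ℂ := fun i => (fl + 1 : ℕ) - ω i - starRingEnd ℂ (ω i) with hθ
  have hθn : ∀ n a b : ℕ, ∑ i, θ i ^ n * (ω i ^ a * starRingEnd ℂ (ω i) ^ b) ∈ S := by
    intro n
    induction n with
    | zero => intro a b; simpa using hab a b
    | succ n ih =>
      intro a b
      have : ∑ i, θ i ^ (n + 1) * (ω i ^ a * starRingEnd ℂ (ω i) ^ b) =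
          (fl + 1 : ℕ) * (∑ i, θ i ^ n * (ω i ^ a * starRingEnd ℂ (ω i) ^ b))
          - (∑ i, θ i ^ n * (ω i ^ (a + 1) * starRingEnd ℂ (ω i) ^ b))
          - (∑ i, θ i ^ n * (ω i ^ a * starRingEnd ℂ (ω i) ^ (b + 1))) := by
        rw [Finset.mul_sum, ← Finset.sum_sub_distrib, ← Finset.sum_sub_distrib]
        refine Finset.sum_congr rfl fun i _ => ?_
        rw [pow_succ]
        conv_lhs => rw [hθ]
        simp only [hθ]
        ring
      rw [this]
      exact sub_mem (sub_mem (mul_mem (hnat _) (ih a b)) (ih _ _)) (ih _ _)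
  have hθp : ∀ n, ∑ i, θ i ^ n ∈ S := fun n => by simpa using hθn n 0 0
  have hes : ∀ n, MvPolynomial.aeval θ (MvPolynomial.esymm ι ℂ n) ∈ S := by
    intro n
    induction n using Nat.strong_induction_on with
    | _ n ih =>
      rcases Nat.eq_zero_or_pos n with rfl | hn
      · simp
      have h := congrArg (MvPolynomial.aeval θ) (MvPolynomial.mul_esymm_eq_sum ι ℂ n)
      simp only [map_mul, map_natCast, map_sum, map_pow, map_neg, map_one, MvPolynomial.psum, MvPolynomial.aeval_X] at h
      have hn0 : (n : ℂ) ≠ 0 := by exact_mod_cast hn.ne'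
      rw [← mul_div_cancel_left₀ (MvPolynomial.aeval θ (MvPolynomial.esymm ι ℂ n)) hn0, h]
      refine div_mem (mul_mem (pow_mem (neg_mem (one_mem S)) _) (sum_mem fun x hx => ?_)) (hnat n)
      rw [Finset.mem_filter] at hx
      exact mul_mem (mul_mem (pow_mem (neg_mem (one_mem S)) _) (ih _ hx.2)) (hθp _)
  have hprodS : ∏ i, θ i ∈ S := by
    have h2 := hes (Fintype.card ι)
    have h3 : Finset.powersetCard (Fintype.card ι) (Finset.univ : Finset ι) = {Finset.univ} := by
      simpa using Finset.powersetCard_self (Finset.univ : Finset ι)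
    rw [MvPolynomial.esymm, h3] at h2
    simpa using h2
  have hθint : ∀ i, IsIntegral ℤ (θ i) := by
    intro i
    refine IsIntegral.sub (IsIntegral.sub ?_ (hintg i)) ?_
    · exact_mod_cast (isIntegral_algebraMap (R := ℤ) (A := ℂ) (x := ((fl + 1 : ℕ) : ℤ)))
    · exact (hintg i).map (starRingEnd ℂ).toIntAlgHom
  have hprodint : IsIntegral ℤ (∏ i, θ i) := IsIntegral.prod _ fun i _ => hθint i
  obtain ⟨r, hr⟩ := hprodS
  have hrint : IsIntegral ℤ r := by
    rw [← hr] at hprodint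
    exact (isIntegral_algebraMap_iff (algebraMap ℚ ℂ).injective).1 hprodint
  obtain ⟨y, hy⟩ := IsIntegrallyClosed.algebraMap_eq_of_integral hrint
  set τ : ι → ℝ := fun i => (fl + 1 : ℕ) - 2 * (ω i).re with hτ
  have hθτ : ∀ i, θ i = (τ i : ℂ) := by
    intro i
    have := Complex.add_conj (ω i)
    simp only [hθ, hτ]
    push_cast at this ⊢
    linear_combination -this
  have hτpos : ∀ i, 0 < τ i := by
    intro i
    have h1 : (ω i).re ≤ Real.sqrt Q := by
      refine (Complex.re_le_norm _).trans (le_of_eq ?_)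
      have := hQ i
      rw [Complex.mul_conj, Complex.normSq_eq_norm_sq] at this
      have h2 : ‖ω i‖ ^ 2 = (Q : ℝ) := by exact_mod_cast this
      rw [← h2, Real.sqrt_sq (norm_nonneg _)]
    have h2 := Nat.lt_floor_add_one (2 * Real.sqrt Q)
    rw [← hfl] at h2
    simp only [hτ]
    push_cast
    linarith
  have hprodτ : ∏ i, τ i = (y : ℝ) := by
    have : ((∏ i, τ i : ℝ) : ℂ) = (y : ℂ) := by
      push_cast
      rw [← Finset.prod_congr rfl (fun i _ => hθτ i), ← hr, ← hy]; simp
    exact_mod_cast this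
  have hy1 : 1 ≤ (y : ℝ) := by
    have : (0 : ℝ) < y := by rw [← hprodτ]; exact Finset.prod_pos fun i _ => hτpos i
    have : 0 < y := by exact_mod_cast this
    exact_mod_cast this
  have hlog : (0 : ℝ) ≤ ∑ i, (τ i - 1) := by
    calc (0 : ℝ) ≤ Real.log (∏ i, τ i) := by rw [hprodτ]; exact Real.log_nonneg hy1
      _ = ∑ i, Real.log (τ i) := Real.log_prod (fun i _ => (hτpos i).ne')
      _ ≤ _ := Finset.sum_le_sum fun i _ => Real.log_le_sub_one_of_pos (hτpos i)
  have : ∑ i, (τ i - 1) = Fintype.card ι * (fl : ℝ) - 2 * ∑ i, (ω i).re := by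
    simp only [hτ]
    push_cast
    rw [Finset.mul_sum, ← nsmul_eq_mul, ← Finset.card_univ, ← Finset.sum_const, ← Finset.sum_sub_distrib]
    refine Finset.sum_congr rfl fun i _ => ?_
    ring
  linarith

theorem hws {k : Type*} [Field k] [Fintype k] (p : ℕ) [Fact p.Prime] [CharP k p] [Algebra (ZMod p) k]
    (f : k[X]) (hd : ¬ p ∣ f.natDegree) (hf0 : f.coeff 0 = 0) :
    (Fintype.card k : ℝ) - ((p : ℝ) - 1) * ((f.natDegree : ℝ) - 1) / 2 * (⌊2 * Real.sqrt (Fintype.card k)⌋₊ : ℝ) ≤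
    p * (Nat.card {x : k // Algebra.trace (ZMod p) k (f.eval x) = 0} : ℝ) := by
  classical
  have hd1 : 1 ≤ f.natDegree := by
    rcases Nat.eq_zero_or_pos f.natDegree with h | h
    · rw [h] at hd; simp at hd
    · exact h
  set Tr := (Algebra.trace (ZMod p) k) with hTr
  let e : ZMod p → AddChar (ZMod p) ℂ := fun t => (ZMod.stdAddChar (N := p)).mulShift t
  let ψ : ZMod p → AddChar k ℂ := fun t => (e t).compAddMonoidHom Tr.toAddMonoidHom
  have hψe : ∀ t a, ψ t a = e t (Tr a) := fun t a => rfl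
  have he : ∀ t, t ≠ 0 → e t ≠ 1 := fun t ht => ZMod.isPrimitive_stdAddChar p ht
  have hsumt : ∀ x : ZMod p, ∑ t : {t : ZMod p // t ≠ 0}, e t.1 x = (if x = 0 then (p : ℂ) else 0) - 1 := by
    intro x
    have h1 := AddChar.sum_mulShift x (ZMod.isPrimitive_stdAddChar p)
    have h2 : ∑ t : ZMod p, e t x = if x = 0 then (p : ℂ) else 0 := by
      rw [ZMod.card] at h1
      rw [← (by split_ifs <;> simp : ((if x = 0 then p else 0 : ℕ) : ℂ) = if x = 0 then (p : ℂ) else 0), ← h1]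
      refine Finset.sum_congr rfl fun t _ => ?_
      simp [e, AddChar.mulShift_apply]
    rw [← h2, ← Finset.sum_erase_add _ _ (Finset.mem_univ (0 : ZMod p))]
    have h3 : e 0 x = 1 := by simp [e, AddChar.mulShift_apply]
    rw [h3, add_sub_cancel_right]
    symm
    refine Finset.sum_subtype _ (fun t => by simp) _
  choose ω hω1 hω2 hω3 using fun t : {t : ZMod p // t ≠ 0} => weil_roots p f hd hf0 (e t) (he t t.2) (ψ t) (hψe t)
  let Ω : {t : ZMod p // t ≠ 0} × Fin (f.natDegree - 1) → ℂ := fun i => ω i.1 i.2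
  have hΩ : ∀ n, 1 ≤ n → ∑ i, Ω i ^ n = - ∑ t : {t : ZMod p // t ≠ 0}, Ssum (ψ t) f n := by
    intro n hn
    rw [Fintype.sum_prod_type, ← Finset.sum_neg_distrib]
    refine Finset.sum_congr rfl fun t _ => ?_
    rw [hω1 t n hn, neg_neg]
  have hcard : Fintype.card ({t : ZMod p // t ≠ 0} × Fin (f.natDegree - 1)) = (p - 1) * (f.natDegree - 1) := by
    rw [Fintype.card_prod, Fintype.card_fin]
    congr 1
    rw [Fintype.card_subtype_compl]; simp [ZMod.card]
  have hmain := serre_bound Ω (Fintype.card k) (fun i => hω3 i.1 i.2) (fun i => hω2 i.1 i.2) (by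
    intro n hn
    rw [hΩ n hn]
    apply neg_mem
    simp only [Ssum]
    rw [Finset.sum_comm]
    refine sum_mem fun P _ => ?_
    rw [← Finset.mul_sum]
    refine mul_mem (natCast_mem _ _) ?_
    have : ∀ t : {t : ZMod p // t ≠ 0}, chi (ψ t) f P.reverse ^ (n / P.natDegree) =
        e t (Tr ((n / P.natDegree) • lam f (P.reverse : PowerSeries k))) := by
      intro t
      rw [← hψe, AddChar.map_nsmul_eq_pow]; rfl
    rw [Finset.sum_congr rfl (fun t _ => this t), hsumt]
    refine sub_mem ?_ (one_mem _)
    split_ifs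
    · exact natCast_mem _ _
    · exact zero_mem _)
  have hS1 : ∑ t : {t : ZMod p // t ≠ 0}, Ssum (ψ t) f 1 =
      p * (Nat.card {x : k // Algebra.trace (ZMod p) k (f.eval x) = 0} : ℂ) - Fintype.card k := by
    have h1 : ∀ t, Ssum (ψ t) f 1 = ∑ x : k, e t (Tr (f.eval x)) := by
      intro t
      have := sum_eq_Ssum (K := k) (ψ t) f hf0
      rw [Module.finrank_self] at this
      rw [← this]
      refine Finset.sum_congr rfl fun x _ => ?_
      rw [Algebra.trace_self_apply, hψe]; simp [Polynomial.aeval_def, Polynomial.eval₂_eq_eval_map]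
    rw [Finset.sum_congr rfl (fun (t : {t : ZMod p // t ≠ 0}) _ => h1 t.1), Finset.sum_comm, Finset.sum_congr rfl (fun x _ => hsumt _),
      Finset.sum_sub_distrib, ← Finset.sum_filter, Finset.sum_const, Nat.card_eq_fintype_card, Fintype.card_subtype]
    simp [mul_comm]
    exact Or.inl rfl
  have h1 := hΩ 1 le_rfl
  rw [hS1] at h1
  change _ ≤ (p : ℝ) * (Nat.card {x : k // Algebra.trace (ZMod p) k (f.eval x) = 0} : ℝ)
  clear hS1
  generalize Nat.card {x : k // Algebra.trace (ZMod p) k (f.eval x) = 0} = M at h1 ⊢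
  have h2 := congrArg Complex.re h1
  simp only [pow_one, Complex.re_sum] at h2
  rw [h2, hcard] at hmain
  have hp1 : 1 ≤ p := (Fact.out : p.Prime).pos
  push_cast [Nat.cast_sub hp1, Nat.cast_sub hd1] at hmain
  simp at hmain
  linarith
end PartC3

section PartD1
open Polynomial


theorem lead_spec (p M r : ℕ) (hp : p.Prime) (hM : 1 ≤ M) (hr : ¬ (p ^ M - 1) ∣ r) :
    ∃ u : ℕ, leadFn p (p ^ M - 1) r ≡ r * p ^ u [MOD (p ^ M - 1)] ∧ ¬ p ∣ leadFn p (p ^ M - 1) r := by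
  set N := p ^ M - 1 with hN
  have hne : {k : ℕ | ∃ u : ℕ, k % N = r * p ^ u % N}.Nonempty := ⟨r, 0, by simp⟩
  obtain ⟨u, hu⟩ := Nat.sInf_mem hne
  have hQ : 1 ≤ p ^ M := Nat.one_le_pow _ _ hp.pos
  have hpN : p ^ M ≡ 1 [MOD N] := ((Nat.modEq_iff_dvd' hQ).2 dvd_rfl).symm
  have hu' : leadFn p N r ≡ r * p ^ u [MOD N] := hu
  refine ⟨u, hu', ?_⟩
  rintro ⟨k, hk⟩
  rcases Nat.eq_zero_or_pos k with rfl | hk0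
  · apply hr
    rw [hk, mul_zero] at hu'
    have h1 : N ∣ r * p ^ u := (Nat.modEq_zero_iff_dvd).1 hu'.symm
    refine Nat.Coprime.dvd_of_dvd_mul_right ?_ h1
    refine Nat.Coprime.pow_right u ?_
    rw [Nat.coprime_comm, hp.coprime_iff_not_dvd]
    intro h
    have h2 : p ∣ p ^ M := dvd_pow_self _ (by omega)
    have h3 : p ∣ 1 := by
      have := Nat.dvd_sub h2 h
      rwa [hN, Nat.sub_sub_self hQ] at this
    exact hp.one_lt.ne' (Nat.dvd_one.1 h3)
  · have hmem : k ∈ {k : ℕ | ∃ u : ℕ, k % N = r * p ^ u % N} := by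
      refine ⟨u + (M - 1), ?_⟩
      have h1 : k ≡ k * p ^ M [MOD N] := by simpa using (hpN.mul_left k).symm
      have h2 : k * p ^ M = p * k * p ^ (M - 1) := by
        obtain ⟨M', rfl⟩ := Nat.exists_eq_add_of_le' hM
        simp [pow_succ]; ring
      rw [h2, ← hk] at h1
      have := h1.trans (hu'.mul_right _)
      rw [mul_assoc, ← pow_add] at this
      exact this
    have h1 : leadFn p N r ≤ k := Nat.sInf_le hmem
    have := hp.two_le
    rw [hk] at h1
    nlinarith

theorem pow_eq_of_modEq_card {E : Type*} [Field E] [Fintype E] (y : E) (a b : ℕ) (ha : a ≠ 0) (hb : b ≠ 0)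
    (h : a ≡ b [MOD (Fintype.card E - 1)]) : y ^ a = y ^ b := by
  by_cases hy : y = 0
  · simp [hy, ha, hb]
  · rw [← Nat.mod_add_div a (Fintype.card E - 1), ← Nat.mod_add_div b (Fintype.card E - 1), pow_add, pow_add,
      pow_mul, pow_mul, FiniteField.pow_card_sub_one_eq_one y hy, one_pow, one_pow]
    rw [show a % _ = b % _ from h]

theorem trace_pow_p {E : Type*} [Field E] [Fintype E] (p : ℕ) [Fact p.Prime] [CharP E p] [Algebra (ZMod p) E]
    (z : E) (u : ℕ) : Algebra.trace (ZMod p) E (z ^ p ^ u) = Algebra.trace (ZMod p) E z := by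
  induction u with
  | zero => simp
  | succ u ih =>
    rw [← ih, pow_succ, pow_mul]
    have := Algebra.trace_eq_of_algEquiv (FiniteField.frobeniusAlgEquivOfAlgebraic (ZMod p) E) (z ^ p ^ u)
    simpa [ZMod.card] using this

theorem bound_single {E ι : Type*} [Field E] [Fintype E] (p : ℕ) [hp : Fact p.Prime] [CharP E p]
    [Algebra (ZMod p) E] (s : Finset ι) (b : ι → E) (e k u : ι → ℕ) (ell : ℕ) (hl : 1 ≤ ell)
    (hk : ∀ i ∈ s, ¬ p ∣ k i) (hke : ∀ i ∈ s, k i ≤ ell)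
    (hy : ∀ i ∈ s, ∀ y : E, y ^ (e i * p ^ u i) = y ^ k i) :
    (Fintype.card E : ℝ) - ((p:ℝ)-1)*((ell:ℝ)-1)/2 * (⌊2*Real.sqrt (Fintype.card E)⌋₊ : ℝ) ≤
      p * (Nat.card {y : E // Algebra.trace (ZMod p) E (∑ i ∈ s, b i * y ^ e i) = 0} : ℝ) := by
  classical
  let f : E[X] := ∑ i ∈ s, C (b i ^ p ^ u i) * X ^ k i
  have hp1 : (1 : ℝ) ≤ p := by exact_mod_cast hp.out.pos
  have hl' : (1 : ℝ) ≤ ell := by exact_mod_cast hl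
  have htr : ∀ y : E, Algebra.trace (ZMod p) E (∑ i ∈ s, b i * y ^ e i) = Algebra.trace (ZMod p) E (f.eval y) := by
    intro y
    simp only [f, eval_finset_sum, map_sum]
    refine Finset.sum_congr rfl fun i hi => ?_
    rw [← trace_pow_p p (b i * y ^ e i) (u i), mul_pow, ← pow_mul, hy i hi y]
    simp
  simp only [htr]
  have hF : (0 : ℝ) ≤ (⌊2*Real.sqrt (Fintype.card E)⌋₊ : ℝ) := by positivity
  by_cases hf : f = 0
  · rw [hf]
    simp
    have h0 : (0 : ℝ) ≤ Fintype.card E := by positivity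
    have h1 : 0 ≤ ((p:ℝ)-1)*((ell:ℝ)-1)/2 * (⌊2*Real.sqrt (Fintype.card E)⌋₊ : ℝ) := by
      have : 0 ≤ ((p:ℝ)-1) := by linarith
      have : 0 ≤ ((ell:ℝ)-1) := by linarith
      positivity
    nlinarith
  · have hco : f.coeff f.natDegree ≠ 0 := by simpa using hf
    have : ∃ i ∈ s, k i = f.natDegree := by
      by_contra! hcon
      apply hco
      conv_lhs => rw [show f = ∑ i ∈ s, C (b i ^ p ^ u i) * X ^ k i from rfl]
      rw [finset_sum_coeff]
      refine Finset.sum_eq_zero fun i hi => ?_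
      rw [coeff_C_mul_X_pow, if_neg]
      exact fun h => hcon i hi h.symm
    obtain ⟨i, hi, hki⟩ := this
    have h0 : f.coeff 0 = 0 := by
      rw [show f = ∑ i ∈ s, C (b i ^ p ^ u i) * X ^ k i from rfl, finset_sum_coeff]
      refine Finset.sum_eq_zero fun i hi => ?_
      rw [coeff_C_mul_X_pow, if_neg]
      intro h
      exact hk i hi (h ▸ dvd_zero p)
    have := hws p f (hki ▸ hk i hi) h0
    refine le_trans ?_ this
    have hle : (f.natDegree : ℝ) ≤ ell := by exact_mod_cast (hki ▸ hke i hi)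
    have : 0 ≤ ((p:ℝ)-1) := by linarith
    gcongr

theorem card_Fq {E : Type*} [Field E] [Fintype E] [DecidableEq E] (q n : ℕ) (hq : 2 ≤ q) (hE : Fintype.card E = q ^ n) :
    (Finset.univ.filter fun c : E => c ^ q = c).card = q := by
  have h1 : (Finset.univ.filter fun c : E => c ^ q = c) =
      insert 0 ((Finset.univ.filter fun v : Eˣ => v ^ (q - 1) = 1).map ⟨Units.val, Units.val_injective⟩) := by
    ext c
    simp only [Finset.mem_filter, Finset.mem_univ, true_and, Finset.mem_insert, Finset.mem_map,
      Function.Embedding.coeFn_mk]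
    have hqq : q = q - 1 + 1 := by omega
    constructor
    · intro h
      by_cases hc : c = 0
      · exact Or.inl hc
      · refine Or.inr ⟨Units.mk0 c hc, ?_, rfl⟩
        ext
        rw [hqq, pow_succ] at h
        simpa using mul_right_cancel₀ hc (h.trans (one_mul c).symm)
    · rintro (rfl | ⟨v, hv, rfl⟩)
      · exact zero_pow (by omega)
      · rw [← Units.val_pow_eq_pow_val, hqq, pow_succ, hv, one_mul]
  rw [h1, Finset.card_insert_of_notMem (by simp), Finset.card_map]
  have h2 := IsCyclic.card_powMonoidHom_ker (G := Eˣ) (q - 1)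
  rw [Nat.card_eq_fintype_card, Nat.card_eq_fintype_card, Fintype.card_units, hE,
    Nat.gcd_eq_right (by simpa using Nat.sub_dvd_pow_sub_pow q 1 n)] at h2
  have h3 : (Finset.univ.filter fun v : Eˣ => v ^ (q - 1) = 1).card = q - 1 := by
    refine Eq.trans ?_ h2
    rw [← Fintype.card_subtype]
    exact Fintype.card_congr (Equiv.subtypeEquivRight fun v => by simp [MonoidHom.mem_ker])
  omega

theorem sum_pow_trace {E : Type*} [Field E] (p m n : ℕ) [Fact p.Prime] [CharP E p] (z : E) :
    ∑ i ∈ Finset.range (n * m), z ^ p ^ i = ∑ j ∈ Finset.range m, (∑ l ∈ Finset.range n, z ^ (p ^ m) ^ l) ^ p ^ j := by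
  simp only [sum_pow_char_pow]
  rw [Finset.sum_comm]
  induction n with
  | zero => simp
  | succ n ih =>
    rw [Nat.succ_mul, Finset.sum_range_add, ih, Finset.sum_range_succ]
    congr 1
    refine Finset.sum_congr rfl fun j _ => ?_
    rw [← pow_mul, ← pow_mul, pow_add, mul_comm m n]

theorem trace_zero_iff {E : Type*} [Field E] [Fintype E] (p m n : ℕ) [Fact p.Prime] [CharP E p] [Algebra (ZMod p) E]
    (hE : Fintype.card E = (p ^ m) ^ n) (z : E) :
    Algebra.trace (ZMod p) E z = 0 ↔
      ∑ j ∈ Finset.range m, (∑ l ∈ Finset.range n, z ^ (p ^ m) ^ l) ^ p ^ j = 0 := by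
  rw [← sum_pow_trace, ← map_eq_zero (algebraMap (ZMod p) E), FiniteField.algebraMap_trace_eq_sum_pow]
  have : Module.finrank (ZMod p) E = n * m := by
    have h := Module.card_eq_pow_finrank (K := ZMod p) (V := E)
    rw [hE, ZMod.card, ← pow_mul, mul_comm] at h
    exact (Nat.pow_right_injective (Fact.out : p.Prime).two_le h).symm
  rw [this]
  simp
end PartD1

section PartD2
open Polynomial

theorem card_add_roots {E : Type*} [Field E] [Fintype E] [DecidableEq E] (p m : ℕ) (hp : p.Prime) (hm : 1 ≤ m)
    (v : E) (hv : v ≠ 0) :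
    (Finset.univ.filter fun c : E => ∑ j ∈ Finset.range m, (c * v) ^ p ^ j = 0).card ≤ p ^ (m - 1) := by
  let P : E[X] := ∑ j ∈ Finset.range m, C (v ^ p ^ j) * X ^ p ^ j
  have hdeg : P.natDegree ≤ p ^ (m - 1) := by
    refine natDegree_sum_le_of_forall_le _ _ fun j hj => ?_
    refine (natDegree_C_mul_X_pow_le _ _).trans ?_
    exact Nat.pow_le_pow_right hp.pos (by have := Finset.mem_range.1 hj; omega)
  have hP : P ≠ 0 := by
    intro h
    have h1 := congrArg (fun f => coeff f 1) h
    simp only [P, finset_sum_coeff, coeff_C_mul_X_pow, coeff_zero] at h1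
    rw [Finset.sum_eq_single 0] at h1
    · simp at h1; exact hv h1
    · intro j _ hj
      rw [if_neg]
      exact (Nat.one_lt_pow hj hp.one_lt).ne
    · intro h; exact absurd (Finset.mem_range.2 (by omega)) h
  refine le_trans ?_ hdeg
  refine le_trans (Finset.card_le_card ?_) (card_roots' P |> (Multiset.toFinset_card_le _).trans)
  intro c hc
  rw [Multiset.mem_toFinset, mem_roots hP, IsRoot.def]
  have := (Finset.mem_filter.1 hc).2
  simp only [P, eval_finset_sum, eval_mul, eval_C, eval_pow, eval_X]
  rw [← this]
  refine Finset.sum_congr rfl fun j _ => ?_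
  rw [mul_pow, mul_comm]

theorem count_main {E : Type*} [Field E] [Fintype E] [DecidableEq E] (p m n : ℕ) [hp : Fact p.Prime] (hm : 1 ≤ m)
    [CharP E p] [Algebra (ZMod p) E]
    (hE : Fintype.card E = (p ^ m) ^ n) (h : E → E) (A : ℝ)
    (hc : ∀ c : E, (Fintype.card E : ℝ) - ((p:ℝ)-1) * A ≤
      p * (Nat.card {y : E // Algebra.trace (ZMod p) E (c * h y) = 0} : ℝ)) :
    (Fintype.card E : ℝ) - ((p ^ m : ℕ) - 1 : ℝ) * A ≤
      (p ^ m : ℕ) * ((Finset.univ.filter fun y : E => ∑ l ∈ Finset.range n, (h y) ^ (p ^ m) ^ l = 0).card : ℝ) := by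
  have hp2 := hp.out.two_le
  have hq2 : 2 ≤ p ^ m := hp2.trans (Nat.le_self_pow (by omega) p)
  set F := Finset.univ.filter fun c : E => c ^ (p ^ m) = c with hF
  have hFc : F.card = p ^ m := card_Fq _ n hq2 hE
  set Z := Finset.univ.filter fun y : E => ∑ l ∈ Finset.range n, (h y) ^ (p ^ m) ^ l = 0 with hZ
  have hcl : ∀ c ∈ F, ∀ l, c ^ (p ^ m) ^ l = c := by
    intro c hcF l
    induction l with
    | zero => simp
    | succ l ih => rw [pow_succ, pow_mul, ih]; exact (Finset.mem_filter.1 hcF).2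
  have htr : ∀ c ∈ F, ∀ y, (Algebra.trace (ZMod p) E (c * h y) = 0 ↔
      ∑ j ∈ Finset.range m, (c * ∑ l ∈ Finset.range n, (h y) ^ (p ^ m) ^ l) ^ p ^ j = 0) := by
    intro c hcF y
    rw [trace_zero_iff p m n hE]
    simp only [mul_pow, hcl c hcF]
    simp only [← Finset.mul_sum, mul_pow]
  have hdc : ∑ c ∈ F, (Finset.univ.filter fun y : E => Algebra.trace (ZMod p) E (c * h y) = 0).card
      = ∑ y : E, (F.filter fun c : E => Algebra.trace (ZMod p) E (c * h y) = 0).card := by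
    simp only [Finset.card_filter]
    rw [Finset.sum_comm]
  have hup : ∀ y : E, p * (F.filter fun c : E => Algebra.trace (ZMod p) E (c * h y) = 0).card
      ≤ p ^ m + (if y ∈ Z then (p - 1) * p ^ m else 0) := by
    intro y
    split_ifs with hy
    · have h1 : (F.filter fun c : E => Algebra.trace (ZMod p) E (c * h y) = 0).card ≤ p ^ m :=
        hFc ▸ Finset.card_filter_le _ _
      have h2 : p ^ m + (p - 1) * p ^ m = p * p ^ m := by
        obtain ⟨p', rfl⟩ := Nat.exists_eq_add_of_le' hp.out.pos
        simp; ring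
      rw [h2]; exact Nat.mul_le_mul_left _ h1
    · have hv : ∑ l ∈ Finset.range n, (h y) ^ (p ^ m) ^ l ≠ 0 := fun h0 => hy (by simp [hZ, h0])
      have h1 := card_add_roots p m hp.out hm _ hv
      have h2 : (F.filter fun c : E => Algebra.trace (ZMod p) E (c * h y) = 0).card ≤ p ^ (m - 1) := by
        refine le_trans (Finset.card_le_card ?_) h1
        intro c hc'
        obtain ⟨hcF, hc0⟩ := Finset.mem_filter.1 hc'
        exact Finset.mem_filter.2 ⟨Finset.mem_univ _, (htr c hcF y).1 hc0⟩
      calc _ ≤ p * p ^ (m - 1) := Nat.mul_le_mul_left _ h2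
        _ = p ^ m + 0 := by rw [← pow_succ', Nat.sub_add_cancel hm, add_zero]
  have hsum : p * ∑ y : E, (F.filter fun c : E => Algebra.trace (ZMod p) E (c * h y) = 0).card
      ≤ Fintype.card E * p ^ m + Z.card * ((p - 1) * p ^ m) := by
    rw [Finset.mul_sum]
    refine (Finset.sum_le_sum fun y _ => hup y).trans ?_
    rw [Finset.sum_add_distrib, Finset.sum_ite_mem]
    simp
  have h0F : (0 : E) ∈ F := by simp [hF]; omega
  have hlow : (p : ℝ) * Fintype.card E + ((p ^ m : ℕ) - 1 : ℝ) * ((Fintype.card E : ℝ) - ((p:ℝ)-1) * A) ≤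
      p * ((∑ c ∈ F, (Finset.univ.filter fun y : E => Algebra.trace (ZMod p) E (c * h y) = 0).card : ℕ) : ℝ) := by
    rw [← Finset.add_sum_erase _ _ h0F]
    push_cast
    rw [mul_add]
    refine add_le_add (by simp) ?_
    rw [Finset.mul_sum]
    have h1 : (F.erase 0).card = p ^ m - 1 := by rw [Finset.card_erase_of_mem h0F, hFc]
    have h2 := Finset.card_nsmul_le_sum (F.erase 0) (fun c => (p : ℝ) * ((Finset.univ.filter fun y : E => Algebra.trace (ZMod p) E (c * h y) = 0).card : ℝ)) _ (fun c _ => by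
      have := hc c
      rwa [Nat.card_eq_fintype_card, Fintype.card_subtype] at this)
    rw [h1, nsmul_eq_mul, Nat.cast_sub (by omega)] at h2
    simpa using h2
  rw [hdc] at hlow
  have hsum' : (p : ℝ) * ((∑ y : E, (F.filter fun c : E => Algebra.trace (ZMod p) E (c * h y) = 0).card : ℕ) : ℝ)
      ≤ Fintype.card E * (p ^ m : ℕ) + Z.card * (((p : ℝ) - 1) * (p ^ m : ℕ)) := by
    have := (Nat.cast_le (α := ℝ)).2 hsum
    rw [Nat.cast_mul, Nat.cast_add, Nat.cast_mul, Nat.cast_mul, Nat.cast_mul, Nat.cast_sub hp.out.pos] at this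
    simpa using this
  have hfin := hlow.trans hsum'
  generalize ((p ^ m : ℕ) : ℝ) = q at hfin ⊢
  have hpp : (0 : ℝ) < (p : ℝ) - 1 := by
    have : (2 : ℝ) ≤ p := by exact_mod_cast hp2
    linarith
  refine le_of_mul_le_mul_left ?_ hpp
  nlinarith
end PartD2

/-- Statement 14 (Hasse–Weil–Serre condition, case `Tr(a_0) = 0`): with `ℓ` as in the
paper, if `q^n + 1 − ((q−1)(ℓ−1)/2)·⌊2 q^{n/2}⌋ > q + 1`, then there is a nonzero `x` with
`Tr_{q^n/q}(L(x)/x) = 0`. -/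
theorem stmt_15 (p m q n : ℕ) (hp : p.Prime) (hm : 1 ≤ m) (hq : q = p ^ m) (hn : 1 ≤ n)
    (E : Type*) [Field E] [Fintype E] (hE : Fintype.card E = q ^ n)
    (a : ℕ → E) (ha : ∃ i : ℕ, 1 ≤ i ∧ i ≤ n - 1 ∧ a i ≠ 0)
    (ell : ℕ)
    (hell : ell = sInf {w : ℕ | ∃ j : ℕ, 1 ≤ j ∧ j ≤ q ^ n - 2 ∧
        Nat.gcd j (q ^ n - 1) = 1 ∧
        w = sSup {k : ℕ | ∃ i : ℕ, 1 ≤ i ∧ i ≤ n - 1 ∧ a i ≠ 0 ∧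
            k = leadFn p (q ^ n - 1) (j * (q ^ i - 1) % (q ^ n - 1))}})
    (hTr : ∑ j ∈ Finset.range n, (a 0) ^ q ^ j = 0)
    (hbound : (q : ℝ) ^ n + 1 -
        (((q : ℝ) - 1) * ((ell : ℝ) - 1) / 2) * (⌊2 * Real.sqrt ((q : ℝ) ^ n)⌋₊ : ℝ) > (q : ℝ) + 1) :
    ∃ x : E, x ≠ 0 ∧
      ∑ j ∈ Finset.range n, ((∑ i ∈ Finset.range n, a i * x ^ q ^ i) / x) ^ q ^ j = 0 := by
  classical
  haveI : Fact p.Prime := ⟨hp⟩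
  have hq2 : 2 ≤ q := hq ▸ hp.two_le.trans (Nat.le_self_pow (by omega) p)
  have hn2 : 2 ≤ n := by obtain ⟨i, h1, h2, -⟩ := ha; omega
  have hQp : q ^ n = p ^ (m * n) := by rw [hq, ← pow_mul]
  have hQ4 : 4 ≤ q ^ n := by
    calc 4 = 2 ^ 2 := by norm_num
      _ ≤ q ^ 2 := Nat.pow_le_pow_left hq2 2
      _ ≤ q ^ n := Nat.pow_le_pow_right (by omega) hn2
  haveI : CharP E p := by
    exact charP_of_card_eq_prime_pow (hE.trans hQp)
  letI : Algebra (ZMod p) E := ZMod.algebra E p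
  have hmem := Nat.sInf_mem (s := {w : ℕ | ∃ j : ℕ, 1 ≤ j ∧ j ≤ q ^ n - 2 ∧
        Nat.gcd j (q ^ n - 1) = 1 ∧
        w = sSup {k : ℕ | ∃ i : ℕ, 1 ≤ i ∧ i ≤ n - 1 ∧ a i ≠ 0 ∧
            k = leadFn p (q ^ n - 1) (j * (q ^ i - 1) % (q ^ n - 1))}})
    ⟨_, 1, le_rfl, by omega, Nat.gcd_one_left _, rfl⟩
  rw [← hell] at hmem
  obtain ⟨j, hj1, -, hjc, hjl⟩ := hmem
  have hle : ∀ i, 1 ≤ i → i ≤ n - 1 → a i ≠ 0 →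
      leadFn p (q ^ n - 1) (j * (q ^ i - 1) % (q ^ n - 1)) ≤ ell := by
    intro i h1 h2 h3
    rw [hjl]
    refine le_csSup ?_ ⟨i, h1, h2, h3, rfl⟩
    refine Set.Finite.bddAbove ?_
    refine ((Finset.range n).finite_toSet.image
      (fun i => leadFn p (q ^ n - 1) (j * (q ^ i - 1) % (q ^ n - 1)))).subset ?_
    rintro k ⟨i, h1, h2, -, rfl⟩
    exact ⟨i, by simp; omega, rfl⟩
  have hnd : ∀ i, 1 ≤ i → i ≤ n - 1 → ¬ (q ^ n - 1) ∣ j * (q ^ i - 1) % (q ^ n - 1) := by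
    intro i h1 h2 h
    have h3 := (Nat.dvd_mod_iff dvd_rfl).1 h
    have h4 := (Nat.Coprime.symm hjc).dvd_of_dvd_mul_left h3
    have h5 : q ^ i < q ^ n := Nat.pow_lt_pow_right (by omega) (by omega)
    have h6 : 1 < q ^ i := Nat.one_lt_pow (by omega) (by omega)
    have := Nat.le_of_dvd (by omega) h4
    omega
  have hsp : ∀ i, ∃ u : ℕ, 1 ≤ i → i ≤ n - 1 →
      (leadFn p (q ^ n - 1) (j * (q ^ i - 1) % (q ^ n - 1)) ≡ j * (q ^ i - 1) * p ^ u [MOD (q ^ n - 1)] ∧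
        ¬ p ∣ leadFn p (q ^ n - 1) (j * (q ^ i - 1) % (q ^ n - 1))) := by
    intro i
    by_cases hi : 1 ≤ i ∧ i ≤ n - 1
    · have h1 := hnd i hi.1 hi.2
      rw [hQp] at h1
      obtain ⟨u, hu1, hu2⟩ := lead_spec p (m * n) _ hp (Nat.mul_pos hm hn) h1
      refine ⟨u, fun _ _ => ?_⟩
      rw [hQp]
      exact ⟨hu1.trans ((Nat.mod_modEq _ _).mul_right _), hu2⟩
    · exact ⟨0, fun h1 h2 => absurd ⟨h1, h2⟩ hi⟩
  choose u hu using hsp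
  let s := (Finset.range n).filter fun i => 1 ≤ i ∧ a i ≠ 0
  have hs : ∀ i ∈ s, 1 ≤ i ∧ i ≤ n - 1 ∧ a i ≠ 0 := by
    intro i hi
    obtain ⟨h1, h2, h3⟩ := Finset.mem_filter.1 hi
    have := Finset.mem_range.1 h1
    exact ⟨h2, by omega, h3⟩
  have hell1 : 1 ≤ ell := by
    obtain ⟨i, h1, h2, h3⟩ := ha
    refine le_trans ?_ (hle i h1 h2 h3)
    exact Nat.pos_of_ne_zero fun h0 => (hu i h1 h2).2 (h0 ▸ dvd_zero p)
  let h : E → E := fun y => ∑ i ∈ s, a i * y ^ (j * (q ^ i - 1))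
  have hcm := count_main p m n hm (by rw [hE, hq]) h
    (((ell:ℝ)-1)/2 * (⌊2*Real.sqrt (Fintype.card E)⌋₊ : ℝ)) (by
      intro c
      have := bound_single p s (fun i => c * a i) (fun i => j * (q ^ i - 1))
        (fun i => leadFn p (q ^ n - 1) (j * (q ^ i - 1) % (q ^ n - 1))) u ell hell1
        (fun i hi => (hu i (hs i hi).1 (hs i hi).2.1).2)
        (fun i hi => hle i (hs i hi).1 (hs i hi).2.1 (hs i hi).2.2)
        (by
          intro i hi y
          obtain ⟨h1, h2, h3⟩ := hs i hi
          obtain ⟨h4, h5⟩ := hu i h1 h2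
          have h6 : 1 < q ^ i := Nat.one_lt_pow (by omega) (by omega)
          refine pow_eq_of_modEq_card y _ _ ?_ (fun h0 => h5 (h0 ▸ dvd_zero p)) (hE ▸ h4.symm)
          exact (Nat.mul_pos (Nat.mul_pos hj1 (by omega)) (pow_pos hp.pos _)).ne')
      simp only [h, Finset.mul_sum, ← mul_assoc] at this ⊢
      convert this using 2
      ring)
  rw [← hq, hE] at hcm
  push_cast at hcm
  have hlt : (q : ℝ) * 1 < q * ((Finset.univ.filter fun y : E => ∑ l ∈ Finset.range n, (h y) ^ q ^ l = 0).card : ℝ) := by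
    refine lt_of_lt_of_le ?_ hcm
    have : ((q : ℝ) - 1) * (((ell:ℝ)-1)/2 * (⌊2*Real.sqrt ((q:ℝ)^n)⌋₊ : ℝ)) =
      (((q : ℝ) - 1) * ((ell : ℝ) - 1) / 2) * (⌊2 * Real.sqrt ((q : ℝ) ^ n)⌋₊ : ℝ) := by ring
    rw [this]
    linarith
  have h1lt := lt_of_mul_lt_mul_left hlt (by positivity)
  have h1lt' : 1 < (Finset.univ.filter fun y : E => ∑ l ∈ Finset.range n, (h y) ^ q ^ l = 0).card := by
    exact_mod_cast h1lt
  obtain ⟨y, hyZ, hy0⟩ := Finset.exists_mem_ne h1lt' 0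
  have hyZ' := (Finset.mem_filter.1 hyZ).2
  have hx0 : y ^ j ≠ 0 := pow_ne_zero _ hy0
  refine ⟨y ^ j, hx0, ?_⟩
  have hLx : (∑ i ∈ Finset.range n, a i * (y ^ j) ^ q ^ i) / (y ^ j) = a 0 + h y := by
    rw [Finset.sum_div]
    have h1 : ∀ i, a i * (y ^ j) ^ q ^ i / y ^ j = a i * y ^ (j * (q ^ i - 1)) := by
      intro i
      have : q ^ i = (q ^ i - 1) + 1 := (Nat.sub_add_cancel (Nat.one_le_pow _ _ (by omega))).symm
      rw [pow_mul]
      conv_lhs => rw [this, pow_succ]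
      field_simp
    simp only [h1]
    rw [← Finset.sum_filter_add_sum_filter_not (Finset.range n) (fun i => 1 ≤ i ∧ a i ≠ 0), add_comm]
    congr 1
    rw [Finset.sum_eq_single 0]
    · simp
    · intro i hi hi0
      have := (Finset.mem_filter.1 hi).2
      have : a i = 0 := by
        by_contra hc
        exact this ⟨by omega, hc⟩
      simp [this]
    · intro h0
      exact absurd (Finset.mem_filter.2 ⟨Finset.mem_range.2 (by omega), by simp⟩) h0
  rw [hLx]
  have : ∀ l, (a 0 + h y) ^ q ^ l = a 0 ^ q ^ l + h y ^ q ^ l := by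
    intro l
    rw [hq, ← pow_mul, add_pow_char_pow]
  simp only [this, Finset.sum_add_distrib, hTr, hyZ', add_zero]
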